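/- If a compact Hausdorff topological group G is, as a topological space, simply connected and an AE(1)-compactum, then G is isomorphic as a topological group to a product ∏_{t∈T} L_t (over some index set T) of simple, connected and simply connected compact Lie groups. -/

import Mathlib

open Topology

universe u

/-- A topological space `Z` has Lebesgue covering dimension at most `n`:
every finite open cover admits a finite open refinement in which each point
lies in at most `n + 1` members. -/
def CovDimLE (Z : Type u) [TopologicalSpace Z] (n : ℕ) : Prop :=
  ∀ 𝒰 : Finset (Set Z), (∀ U ∈ 𝒰, IsOpen U) → ⋃₀ (𝒰 : Set (Set Z)) = Set.univ →
    ∃ 𝒱 : Finset (Set Z), (∀ V ∈ 𝒱, IsOpen V) ∧ ⋃₀ (𝒱 : Set (Set Z)) = Set.univ ∧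
      (∀ V ∈ 𝒱, ∃ U ∈ 𝒰, V ⊆ U) ∧
      ∀ z : Z, Nat.card {V : Set Z // V ∈ 𝒱 ∧ z ∈ V} ≤ n + 1

/-- `X` is an absolute extensor in dimension `n` (an AE(n)-space): every continuous map
into `X` from a closed subspace of a compact Hausdorff space of covering dimension
at most `n` extends continuously over the whole space. -/
def IsAE (n : ℕ) (X : Type u) [TopologicalSpace X] : Prop :=
  ∀ (Z : Type u) [TopologicalSpace Z], CompactSpace Z → T2Space Z → CovDimLE Z n →
    ∀ Z₀ : Set Z, IsClosed Z₀ → ∀ g₀ : C(Z₀, X),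
      ∃ g : C(Z, X), ∀ z : Z₀, g (z : Z) = g₀ z

/-- `X` is an absolute neighborhood extensor in dimension `4` (an ANE(4)-space):
every continuous map into `X` from a closed subspace `Z₀` of a compact Hausdorff
space of covering dimension at most `4` extends continuously over some open
neighborhood of `Z₀`. -/
def IsANE4 (X : Type u) [TopologicalSpace X] : Prop :=
  ∀ (Z : Type u) [TopologicalSpace Z], CompactSpace Z → T2Space Z → CovDimLE Z 4 →
    ∀ Z₀ : Set Z, IsClosed Z₀ → ∀ g₀ : C(Z₀, X),
      ∃ (U : Set Z) (_ : IsOpen U) (hZ₀U : Z₀ ⊆ U) (g : C(U, X)),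
        ∀ (z : Z) (hz : z ∈ Z₀), g ⟨z, hZ₀U hz⟩ = g₀ ⟨z, hz⟩

/-- The underlying space of `X` is a topological manifold: every point has an open
neighborhood homeomorphic to an open subset of some Euclidean space. -/
def IsTopManifold (X : Type u) [TopologicalSpace X] : Prop :=
  ∀ x : X, ∃ (n : ℕ) (U : Set X) (V : Set (EuclideanSpace ℝ (Fin n))),
    IsOpen U ∧ x ∈ U ∧ IsOpen V ∧ Nonempty (U ≃ₜ V)

/-- The multiplicative equivalence `e` is an isomorphism of topological groups,
i.e. it is continuous with continuous inverse. -/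
def IsTopGroupIso {G H : Type*} [Group G] [Group H] [TopologicalSpace G]
    [TopologicalSpace H] (e : G ≃* H) : Prop :=
  Continuous e ∧ Continuous e.symm

/-- A package consisting of a compact Hausdorff topological group. -/
structure CompactGroupPkg : Type (u + 1) where
  carrier : Type u
  [topology : TopologicalSpace carrier]
  [group : Group carrier]
  [topGroup : IsTopologicalGroup carrier]
  [compact : CompactSpace carrier]
  [t2 : T2Space carrier]

attribute [instance] CompactGroupPkg.topology CompactGroupPkg.group
  CompactGroupPkg.topGroup CompactGroupPkg.compact CompactGroupPkg.t2

/-- `L` is a simple, connected and simply connected compact Lie group: a compact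
Hausdorff topological group whose underlying space is a topological manifold,
which is connected, simply connected, nonabelian, and all of whose closed
normal subgroups other than the whole group are finite. -/
def IsSimpleSCSCLieGroup (L : CompactGroupPkg.{u}) : Prop :=
  IsTopManifold L.carrier ∧ ConnectedSpace L.carrier ∧ SimplyConnectedSpace L.carrier ∧
    (∃ a b : L.carrier, a * b ≠ b * a) ∧
    ∀ N : Subgroup L.carrier, N.Normal → IsClosed (N : Set L.carrier) → N ≠ ⊤ → Finite N

open unitInterval in
/-- The product of a totally disconnected compact Hausdorff space with the unit interval has
covering dimension at most one. -/
theorem covDimLE_one_prod_unitInterval (D : Type u) [TopologicalSpace D] [CompactSpace D]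
    [T2Space D] [TotallyDisconnectedSpace D] : CovDimLE (D × I) 1 := by
  classical
  intro 𝒰 hopen hcover
  have key : ∀ d : D, ∃ (n : ℕ) (W : Set D), 0 < n ∧ IsClopen W ∧ d ∈ W ∧
      ∀ k ≤ n, ∃ U ∈ 𝒰, W ×ˢ {t : I | |(n : ℝ) * t - k| < 1} ⊆ U := by
    intro d
    obtain ⟨δ, hδ, hball⟩ := lebesgue_number_lemma_of_metric (s := (Set.univ : Set I))
      (c := fun U : 𝒰 => {t : I | (d, t) ∈ U.1}) isCompact_univ
      (fun U => (hopen U.1 U.2).preimage (by fun_prop)) (by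
        intro t _
        have : (d, t) ∈ ⋃₀ (𝒰 : Set (Set (D × I))) := hcover ▸ Set.mem_univ _
        obtain ⟨U, hU, hm⟩ := this
        exact Set.mem_iUnion.2 ⟨⟨U, hU⟩, hm⟩)
    obtain ⟨m, hm⟩ := exists_nat_gt (1 / δ)
    have hm0 : (0 : ℝ) < m := lt_trans (by positivity) hm
    have hm1 : 1 < δ * m := by rwa [div_lt_iff₀' hδ] at hm
    have step : ∀ k : Fin (m + 1), ∃ U ∈ 𝒰, ∃ W : Set D, IsOpen W ∧ d ∈ W ∧
        W ×ˢ {t : I | |(m : ℝ) * t - (k : ℕ)| ≤ 1} ⊆ U := by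
      intro k
      have hk : ((k : ℕ) : ℝ) ≤ m := by exact_mod_cast Nat.lt_succ_iff.1 k.2
      obtain ⟨⟨U, hU⟩, hsub⟩ := hball
        ⟨(k : ℕ) / m, by positivity, by rw [div_le_one hm0]; exact hk⟩ (Set.mem_univ _)
      obtain ⟨u, v, hu, -, hdu, hv, huv⟩ := generalized_tube_lemma (isCompact_singleton (x := d))
        (t := {t : I | |(m : ℝ) * t - (k : ℕ)| ≤ 1})
        (IsClosed.isCompact (isClosed_le (by fun_prop) (by fun_prop))) (hopen U hU) (by
          rintro ⟨d', t⟩ ⟨rfl, ht⟩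
          apply hsub
          simp only [Metric.mem_ball, Subtype.dist_eq, Real.dist_eq]
          have : (t : ℝ) - (k : ℕ) / m = ((m : ℝ) * t - (k : ℕ)) / m := by field_simp
          rw [this, abs_div, abs_of_pos hm0, div_lt_iff₀ hm0]
          exact lt_of_le_of_lt ht hm1)
      exact ⟨U, hU, u, hu, hdu rfl, (Set.prod_mono le_rfl hv).trans huv⟩
    choose U hU W hWo hdW hWU using step
    obtain ⟨C, ⟨hdC, hC⟩, hCW⟩ := (nhds_basis_clopen d).mem_iff.1
      ((isOpen_iInter_of_finite hWo).mem_nhds (Set.mem_iInter.2 hdW))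
    refine ⟨m, C, by exact_mod_cast hm0, hC, hdC, fun k hk => ⟨U ⟨k, by omega⟩, hU _, ?_⟩⟩
    rintro ⟨x, t⟩ ⟨hx, ht⟩
    exact hWU ⟨k, by omega⟩ ⟨Set.mem_iInter.1 (hCW hx) _, (le_of_lt ht : |(m : ℝ) * t - k| ≤ 1)⟩
  choose n W hn hW hdW hWU using key
  obtain ⟨s, hs⟩ := isCompact_univ.elim_finite_subcover W (fun d => (hW d).isOpen)
    (fun d _ => Set.mem_iUnion.2 ⟨d, hdW d⟩)
  let e : Fin s.card → D := fun i => (s.equivFin.symm i).1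
  have he : ∀ x : D, ∃ i, x ∈ W (e i) := by
    intro x
    obtain ⟨d, hd, hx⟩ := Set.mem_iUnion₂.1 (hs (Set.mem_univ x))
    exact ⟨s.equivFin ⟨d, hd⟩, by simpa [e] using hx⟩
  let C : Fin s.card → Set D := fun i => W (e i) \ ⋃ j : {j // j < i}, W (e j)
  have hC : ∀ i, IsOpen (C i) := fun i =>
    (hW _).isOpen.sdiff (isClosed_iUnion_of_finite fun j => (hW _).isClosed)
  have hCex : ∀ x : D, ∃ i, x ∈ C i := by
    intro x
    obtain ⟨i, hi, hmin⟩ := WellFounded.has_min (wellFounded_lt (α := Fin s.card))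
      {i | x ∈ W (e i)} (he x)
    refine ⟨i, hi, fun h => ?_⟩
    obtain ⟨⟨j, hj⟩, hx⟩ := Set.mem_iUnion.1 h
    exact hmin j hx hj
  have hCuniq : ∀ x i j, x ∈ C i → x ∈ C j → i = j := by
    intro x i j hi hj
    by_contra hne
    rcases lt_or_gt_of_ne hne with h | h
    · exact hj.2 (Set.mem_iUnion.2 ⟨⟨i, h⟩, hi.1⟩)
    · exact hi.2 (Set.mem_iUnion.2 ⟨⟨j, h⟩, hj.1⟩)
  let J : Fin s.card → ℕ → Set I := fun i k => {t : I | |(n (e i) : ℝ) * t - k| < 1}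
  refine ⟨Finset.univ.biUnion fun i =>
    (Finset.range (n (e i) + 1)).image fun k => C i ×ˢ J i k, ?_, ?_, ?_, ?_⟩
  · intro V hV
    simp only [Finset.mem_biUnion, Finset.mem_image] at hV
    obtain ⟨i, -, k, -, rfl⟩ := hV
    exact (hC i).prod (isOpen_lt (by fun_prop) (by fun_prop))
  · refine Set.eq_univ_of_forall fun ⟨x, t⟩ => ?_
    obtain ⟨i, hi⟩ := hCex x
    have h0 : (0 : ℝ) ≤ n (e i) * t := mul_nonneg (by positivity) t.2.1
    refine ⟨C i ×ˢ J i ⌊(n (e i) : ℝ) * t⌋₊, ?_, hi, ?_⟩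
    · simp only [Finset.mem_coe, Finset.mem_biUnion, Finset.mem_image, Finset.mem_univ, true_and,
        Finset.mem_range]
      refine ⟨i, _, Nat.lt_succ_of_le (Nat.floor_le_of_le ?_), rfl⟩
      exact mul_le_of_le_one_right (by positivity) t.2.2
    · change |(n (e i) : ℝ) * t - (⌊(n (e i) : ℝ) * t⌋₊ : ℕ)| < 1
      have h1 := Nat.floor_le h0
      have h2 := Nat.lt_floor_add_one ((n (e i) : ℝ) * t)
      rw [abs_lt]
      constructor <;> linarith
  · intro V hV
    simp only [Finset.mem_biUnion, Finset.mem_image, Finset.mem_range] at hV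
    obtain ⟨i, -, k, hk, rfl⟩ := hV
    obtain ⟨U, hU, hsub⟩ := hWU (e i) k (by omega)
    exact ⟨U, hU, (Set.prod_mono Set.sdiff_subset le_rfl).trans hsub⟩
  · rintro ⟨x, t⟩
    obtain ⟨i, hi⟩ := hCex x
    have hsub : {V : Set (D × I) | V ∈ (Finset.univ.biUnion fun i =>
        (Finset.range (n (e i) + 1)).image fun k => C i ×ˢ J i k) ∧ (x, t) ∈ V} ⊆
        {C i ×ˢ J i ⌊(n (e i) : ℝ) * t⌋₊, C i ×ˢ J i (⌊(n (e i) : ℝ) * t⌋₊ + 1)} := by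
      intro V hV'
      obtain ⟨hV, hxt⟩ := Set.mem_ofPred_eq ▸ hV'
      simp only [Finset.mem_biUnion, Finset.mem_image, Finset.mem_range] at hV
      obtain ⟨j, -, k, hk, rfl⟩ := hV
      obtain ⟨hx, ht⟩ := hxt
      obtain rfl := hCuniq x _ _ hx hi
      have h0 : (0 : ℝ) ≤ n (e j) * t := mul_nonneg (by positivity) t.2.1
      have ht' : |(n (e j) : ℝ) * t - k| < 1 := ht
      rw [abs_lt] at ht'
      have h1 := Nat.floor_le h0
      have h2 := Nat.lt_floor_add_one ((n (e j) : ℝ) * t)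
      have h3 : k < ⌊(n (e j) : ℝ) * t⌋₊ + 2 := by
        have : (k : ℝ) < (⌊(n (e j) : ℝ) * t⌋₊ + 2 : ℕ) := by push_cast; linarith
        exact_mod_cast this
      have h4 : ⌊(n (e j) : ℝ) * t⌋₊ < k + 1 := by
        have : (⌊(n (e j) : ℝ) * t⌋₊ : ℝ) < (k + 1 : ℕ) := by push_cast; linarith
        exact_mod_cast this
      have h5 : k = ⌊(n (e j) : ℝ) * t⌋₊ ∨ k = ⌊(n (e j) : ℝ) * t⌋₊ + 1 := by omega
      rcases h5 with h | h
      · exact Or.inl (by rw [← h])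
      · exact Or.inr (by rw [← h]; rfl)
    exact (Set.ncard_le_ncard hsub (Set.toFinite _)).trans ((Set.ncard_insert_le _ _).trans (by simp))

open unitInterval in
/-- A compact Hausdorff absolute extensor in dimension one is locally path connected. -/
theorem IsAE.locallyPathConnectedSpace {X : Type u} [TopologicalSpace X] [CompactSpace X]
    [T2Space X] (h : IsAE 1 X) : LocallyPathConnectedSpace X := by
  rw [locallyPathConnectedSpace_iff_pathComponentIn_mem_nhds]
  intro x U hU hxU
  let f : Ultrafilter X → X := Ultrafilter.extend id
  have hf : Continuous f := continuous_ultrafilter_extend id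
  have hfs : ∀ y, f (pure y) = y := fun y => ultrafilter_extend_pure id y
  let A : Set (Ultrafilter X × I) := {p | p.2 = 1}
  let B : Set (Ultrafilter X × I) := {p | p.2 = 0 ∨ f p.1 = x}
  have hA : IsClosed A := isClosed_eq continuous_snd continuous_const
  have hB : IsClosed B := (isClosed_eq continuous_snd continuous_const).union
    (isClosed_eq (hf.comp continuous_fst) continuous_const)
  classical
  let F : Ultrafilter X × I → X := fun p => if p.2 = 1 then f p.1 else x
  have hFA : ContinuousOn F A := (hf.comp continuous_fst).continuousOn.congr
    fun p hp => if_pos hp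
  have hFBx : ∀ p ∈ B, F p = x := by
    rintro p (hp | hp)
    · have : p.2 ≠ 1 := by rw [hp]; exact zero_ne_one
      exact if_neg this
    · by_cases h1 : p.2 = 1
      · simp [F, h1, hp]
      · simp [F, h1]
  have hFB : ContinuousOn F B := continuousOn_const.congr hFBx
  obtain ⟨g, hg⟩ := h (Ultrafilter X × I) inferInstance inferInstance
    (covDimLE_one_prod_unitInterval _) (A ∪ B) (hA.union hB)
    ⟨(A ∪ B).domRestrict F, (hFA.union_of_isClosed hFB hA hB).domRestrict⟩
  have hgF : ∀ p ∈ A ∪ B, g p = F p := fun p hp => hg ⟨p, hp⟩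
  let V : Set (Ultrafilter X) := {z | ∃ t : I, g (z, t) ∉ U}
  have hV : IsClosed V := by
    have : V = Prod.fst '' (g ⁻¹' Uᶜ) := by
      ext z
      constructor
      · rintro ⟨t, ht⟩
        exact ⟨(z, t), ht, rfl⟩
      · rintro ⟨⟨z, t⟩, ht, rfl⟩
        exact ⟨t, ht⟩
    rw [this]
    exact isClosedMap_fst_of_compactSpace _ (hU.isClosed_compl.preimage g.continuous)
  have hfV : IsClosed (f '' V) := hf.isClosedMap _ hV
  have hx : x ∉ f '' V := by
    rintro ⟨z, ⟨t, ht⟩, hz⟩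
    rw [hgF (z, t) (Or.inr (Or.inr hz)), hFBx _ (Or.inr hz)] at ht
    exact ht hxU
  filter_upwards [hfV.isOpen_compl.mem_nhds hx] with y hy
  refine ⟨⟨⟨fun t => g (pure y, t), by fun_prop⟩, ?_, ?_⟩, ?_⟩
  · exact (hgF _ (Or.inr (Or.inl rfl))).trans (hFBx _ (Or.inl rfl))
  · exact (hgF (pure y, 1) (Or.inl rfl)).trans (by simp [F, hfs])
  · intro t
    by_contra ht
    exact hy ⟨pure y, ⟨t, ht⟩, hfs y⟩

/-- A totally disconnected normal subgroup of a connected topological group is central. -/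
theorem Subgroup.mul_comm_of_totallyDisconnected {G : Type*} [Group G] [TopologicalSpace G]
    [IsTopologicalGroup G] [PreconnectedSpace G] (N : Subgroup G) [hN : N.Normal]
    [TotallyDisconnectedSpace N] (g : G) {n : G} (hn : n ∈ N) : g * n = n * g := by
  let φ : G → N := fun g => ⟨g * n * g⁻¹, hN.conj_mem n hn g⟩
  have hφ : Continuous φ := by fun_prop
  have hsub := (isPreconnected_range hφ).subsingleton
  have := Subtype.ext_iff.1 (hsub ⟨g, rfl⟩ ⟨1, rfl⟩)
  simp only [φ, one_mul, inv_one, mul_one] at this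
  exact mul_inv_eq_iff_eq_mul.1 this

/-- Lifts through a quotient homomorphism with totally disconnected kernel are determined by
their values over a simply connected, locally path connected parameter space. -/
theorem MonoidHom.eq_of_lift_of_totallyDisconnected_ker {K P B Y : Type*} [Group K]
    [TopologicalSpace K] [IsTopologicalGroup K] [CompactSpace K] [T2Space K] [PreconnectedSpace K]
    [Group P] [TopologicalSpace P] [T2Space P] (p : K →* P)
    (hp : Continuous p) (hsurj : Function.Surjective p) [TotallyDisconnectedSpace p.ker]
    [TopologicalSpace B] [SimplyConnectedSpace B] [LocallyPathConnectedSpace B]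
    {f : B → P} (hf : Continuous f) [TopologicalSpace Y] [PreconnectedSpace Y] {h : Y → K}
    (hh : Continuous h) {q : Y → B} (hq : Continuous q) (hcomm : ∀ y, f (q y) = p (h y))
    {y y' : Y} (hyy : q y = q y') : h y = h y' := by
  have hkc : IsClosed (p.ker : Set K) := isClosed_singleton.preimage hp
  have : CompactSpace p.ker := isCompact_iff_compactSpace.1 hkc.isCompact
  by_contra hne
  let d : p.ker := ⟨(h y)⁻¹ * h y', by
    rw [MonoidHom.mem_ker, map_mul, map_inv, ← hcomm, ← hcomm, hyy, inv_mul_cancel]⟩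
  have hd : (1 : p.ker) ∈ ({d}ᶜ : Set p.ker) := by
    intro h1
    have h2 : (1 : p.ker) = d := h1
    exact hne (inv_mul_eq_one.1 (Subtype.ext_iff.1 h2).symm)
  obtain ⟨O, hO⟩ := ProfiniteGrp.exist_openNormalSubgroup_sub_open_nhds_of_one
    isOpen_compl_singleton hd
  let D : Subgroup K := O.toSubgroup.map p.ker.subtype
  have hOc : IsClosed (O.toSubgroup : Set p.ker) := O.toOpenSubgroup.isClosed
  have hDc : IsClosed (D : Set K) := by
    have := (hOc.isCompact.image continuous_subtype_val).isClosed
    simpa [D] using this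
  have hDle : D ≤ p.ker := Subgroup.map_subtype_le _
  have : D.Normal := ⟨fun n hn g => by
    rw [p.ker.mul_comm_of_totallyDisconnected g (hDle hn), mul_inv_cancel_right]
    exact hn⟩
  let p₁ : K ⧸ D →* P := QuotientGroup.lift D p (fun x hx => hDle hx)
  have hp₁ : Continuous p₁ := continuous_quot_lift _ hp
  have hs₁ : Function.Surjective p₁ := fun x => by
    obtain ⟨k, rfl⟩ := hsurj x
    exact ⟨(k : K ⧸ D), rfl⟩
  have hfin : (p₁.ker : Set (K ⧸ D)).Finite := by
    have : Finite (p.ker ⧸ O.toSubgroup) := O.toSubgroup.quotient_finite_of_isOpen O.isOpen'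
    let φ : p.ker ⧸ O.toSubgroup → K ⧸ D := Quotient.lift (fun k => ((k : K) : K ⧸ D)) (by
      intro a b hab
      have hab' := QuotientGroup.leftRel_apply.1 hab
      exact QuotientGroup.eq.2 ⟨_, hab', rfl⟩)
    refine (Set.finite_range φ).subset ?_
    intro x hx
    obtain ⟨k, rfl⟩ := QuotientGroup.mk_surjective x
    exact ⟨QuotientGroup.mk (⟨k, hx⟩ : p.ker), rfl⟩
  have hquot : IsQuotientMap p₁ := hp₁.isClosedMap.isQuotientMap hp₁ hs₁
  have hdisc : IsDiscrete (p₁.ker : Set (K ⧸ D)) := hfin.isDiscrete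
  have hcov := (hquot.isQuotientCoveringMap_of_isDiscrete_ker_monoidHom hdisc).isCoveringMap
  obtain ⟨F, ⟨hF1, hF2⟩, -⟩ := hcov.existsUnique_continuousMap_lifts ⟨f, hf⟩ (q y)
    ((h y : K) : K ⧸ D) (hcomm y).symm
  have : DiscreteTopology p₁.ker := isDiscrete_iff_discreteTopology.1 hdisc
  let m : Y → p₁.ker := fun z => ⟨((h z : K) : K ⧸ D) * (F (q z))⁻¹, by
    have h1 : p₁ (F (q z)) = f (q z) := congrFun hF2 (q z)
    have h2 : p₁ ((h z : K) : K ⧸ D) = p (h z) := rfl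
    rw [MonoidHom.mem_ker, map_mul, map_inv, h1, h2, hcomm, mul_inv_cancel]⟩
  have hm : Continuous m := by
    have : Continuous fun z => ((h z : K) : K ⧸ D) := continuous_quotient_mk'.comp hh
    exact Continuous.subtype_mk (this.mul ((F.continuous.comp hq).inv)) _
  have hconst := Subtype.ext_iff.1 (PreconnectedSpace.constant ‹_› hm (x := y) (y := y'))
  simp only [m, ← hyy, mul_left_inj, QuotientGroup.eq] at hconst
  obtain ⟨o, ho, hoe⟩ := hconst
  have hod : o = d := Subtype.ext hoe
  exact hO ho (by rw [hod]; rfl)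

/-- A compact group which is simply connected and locally path connected has no nontrivial
connected compact group extension with totally disconnected kernel. -/
theorem MonoidHom.injective_of_totallyDisconnected_ker {K G : Type*} [Group K]
    [TopologicalSpace K] [IsTopologicalGroup K] [CompactSpace K] [T2Space K] [PreconnectedSpace K]
    [Group G] [TopologicalSpace G] [T2Space G] [SimplyConnectedSpace G]
    [LocallyPathConnectedSpace G] (p : K →* G) (hp : Continuous p) (hsurj : Function.Surjective p)
    [TotallyDisconnectedSpace p.ker] : Function.Injective p := fun _ _ hxy =>
  p.eq_of_lift_of_totallyDisconnected_ker hp hsurj (f := fun x : G => x) continuous_id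
    (h := fun x : K => x) continuous_id (q := p) hp (fun _ => rfl) hxy

/-- Every bounded continuous character of a simply connected, locally path connected compact
group into the circle is trivial. -/
theorem MonoidHom.circle_eq_one_of_simplyConnected {G : Type*} [Group G] [TopologicalSpace G]
    [CompactSpace G] [IsTopologicalGroup G] [SimplyConnectedSpace G] [LocallyPathConnectedSpace G]
    (χ : G →* Circle) (hχ : Continuous χ) (g : G) : χ g = 1 := by
  obtain ⟨F, ⟨hF1, hF2⟩, -⟩ := Circle.isCoveringMap_exp.existsUnique_continuousMap_lifts
    ⟨χ, hχ⟩ (1 : G) (0 : ℝ) (by simp)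
  have hF : ∀ x, Circle.exp (F x) = χ x := fun x => congrFun hF2 x
  have hadd : ∀ x y, F (x * y) = F x + F y := by
    intro x y
    have := Circle.isCoveringMap_exp.eq_of_comp_eq (A := G) (g₁ := fun y => F (x * y))
      (g₂ := fun y => F x + F y) (by fun_prop) (by fun_prop) (by
        funext z
        simp [hF, Circle.exp_add]) 1 (by simp [hF1])
    exact congrFun this y
  have hpow : ∀ n : ℕ, F (g ^ n) = n * F g := by
    intro n
    induction n with
    | zero => simp [hF1]
    | succ n ih => rw [pow_succ, hadd, ih]; push_cast; ring
  obtain ⟨C, hC⟩ := isCompact_univ.exists_bound_of_continuousOn (f := F) F.continuous.continuousOn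
  have h0 : F g = 0 := by
    by_contra hne
    obtain ⟨n, hn⟩ := exists_nat_gt (C / |F g|)
    have := hC (g ^ n) (Set.mem_univ _)
    rw [hpow, Real.norm_eq_abs, abs_mul, Nat.abs_cast] at this
    rw [div_lt_iff₀ (abs_pos.2 hne)] at hn
    linarith
  rw [← hF, h0, Circle.exp_zero]

section PeterWeyl
open MeasureTheory InnerProductSpace Module.End

/-- A vector moved by a strongly continuous unitary representation of a compact group is not
orthogonal to all finite-dimensional invariant subspaces. -/
theorem exists_finiteDimensional_invariant_of_apply_ne {G H : Type*} [Group G]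
    [TopologicalSpace G] [IsTopologicalGroup G] [CompactSpace G]
    [NormedAddCommGroup H] [InnerProductSpace ℂ H] [CompleteSpace H] (π : G →* (H →L[ℂ] H))
    (hπ : ∀ v, Continuous fun g => π g v)
    (hinner : ∀ g v w, inner ℂ (π g v) (π g w) = inner ℂ v w) {g : G} {v : H}
    (hgv : π g v ≠ v) :
    ∃ W : Submodule ℂ H, FiniteDimensional ℂ W ∧ (∀ h, ∀ w ∈ W, π h w ∈ W) ∧
      ∃ w ∈ W, π g w ≠ w := by
  by_contra! hcon
  let _ : MeasurableSpace G := borel G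
  have : BorelSpace G := ⟨rfl⟩
  let μ : Measure G := Measure.haarMeasure ⊤
  have : IsProbabilityMeasure μ := ⟨by
    simpa [μ] using Measure.haarMeasure_self (K₀ := (⊤ : TopologicalSpace.PositiveCompacts G))⟩
  let φ : H := π g v - v
  have hφ0 : φ ≠ 0 := sub_ne_zero.2 hgv
  have hφc : Continuous fun h => π h φ := hπ φ
  have hortho : ∀ W : Submodule ℂ H, FiniteDimensional ℂ W → (∀ h, ∀ w ∈ W, π h w ∈ W) →
      ∀ w ∈ W, inner ℂ w φ = 0 := by
    intro W hW hinv w hw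
    rw [inner_sub_right, ← hinner g w v, hcon W hW hinv w hw, sub_self]
  let R : G → H →L[ℂ] H := fun h => rankOne ℂ (π h φ) (π h φ)
  have hRc : Continuous R := by
    have h1 : Continuous fun x : H => rankOne ℂ x x := by
      refine continuous_iff_continuousAt.2 fun x => ?_
      have h2 : (fun x : H => rankOne ℂ x x) = fun x : H =>
          ContinuousLinearMap.smulRightL ℂ H H (innerSL ℂ x) x := rfl
      rw [h2]
      have h3 : Continuous fun x : H => ContinuousLinearMap.smulRightL ℂ H H (innerSL ℂ x) :=
        (ContinuousLinearMap.continuous _).comp (innerSL ℂ).continuous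
      exact (h3.clm_apply continuous_id).continuousAt
    exact h1.comp hφc
  have hRi : Integrable R μ := hRc.integrable_of_hasCompactSupport (.of_compactSpace _)
  let T : H →L[ℂ] H := ∫ h, R h ∂μ
  have hTv : ∀ x, T x = ∫ h, inner ℂ (π h φ) x • π h φ ∂μ := fun x =>
    ContinuousLinearMap.integral_apply hRi x
  have hint : ∀ x, Integrable (fun h => inner ℂ (π h φ) x • π h φ) μ := fun x =>
    ((hφc.inner continuous_const).smul hφc).integrable_of_hasCompactSupport (.of_compactSpace _)
  have hTinner : ∀ x y, inner ℂ x (T y) = ∫ h, inner ℂ (π h φ) y * inner ℂ x (π h φ) ∂μ := by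
    intro x y
    rw [hTv, ← innerSL_apply_apply, ← ContinuousLinearMap.integral_comp_comm _ (hint y)]
    simp
  have hTcomm : ∀ k x, T (π k x) = π k (T x) := by
    intro k x
    rw [hTv, hTv, ← ContinuousLinearMap.integral_comp_comm _ (hint x),
      ← integral_mul_left_eq_self _ k]
    simp [hinner]
  have hTsymm : T.IsSymmetric := by
    intro x y
    have h1 : inner ℂ (T x) y = starRingEnd ℂ (inner ℂ y (T x)) := (inner_conj_symm _ _).symm
    change inner ℂ (T x) y = inner ℂ x (T y)
    rw [h1, hTinner, hTinner, ← integral_conj]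
    simp [mul_comm]
  have hTcpt : IsCompactOperator T := by
    have hcl : IsClosed {f : H →L[ℂ] H | IsCompactOperator f} :=
      isClosed_setOfPred_isCompactOperator
    have hconv : Convex ℝ {f : H →L[ℂ] H | IsCompactOperator f} := by
      intro f hf f' hf' a b _ _ _
      exact (hf.smul a).add (hf'.smul b)
    refine hconv.integral_mem hcl (.of_forall fun h => ?_) hRi
    have : IsCompactOperator (ContinuousLinearMap.toSpanSingleton ℂ (π h φ)) :=
      isCompactOperator_of_locallyCompactSpace_rng
        (ContinuousLinearMap.toSpanSingleton ℂ (π h φ))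
    exact this.comp_clm (innerSL ℂ (π h φ))
  have hT0 : T φ = 0 := by
    have : T φ ∈ (⨆ μ, eigenspace (T : Module.End ℂ H) μ)ᗮ := by
      rw [← Submodule.iInf_orthogonal, Submodule.mem_iInf]
      intro c w hw
      have hw' : T w = c • w := mem_eigenspace_iff.1 hw
      have h1 : inner ℂ w (T φ) = inner ℂ (T w) φ := (hTsymm w φ).symm
      rw [h1, hw', inner_smul_left]
      rcases eq_or_ne c 0 with rfl | hc
      · simp
      rw [hortho _ (ContinuousLinearMap.finite_dimensional_eigenspace hTcpt c hc) ?_ w hw, mul_zero]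
      intro h x hx
      rw [mem_eigenspace_iff] at hx ⊢
      change T x = _ at hx
      change T _ = _
      rw [hTcomm, hx, map_smul]
    rw [ContinuousLinearMap.orthogonalComplement_iSup_eigenspaces_eq_bot hTcpt hTsymm] at this
    exact this
  have h2 : inner ℂ φ (T φ) = ((∫ h, ‖inner ℂ (π h φ) φ‖ ^ 2 ∂μ : ℝ) : ℂ) := by
    rw [hTinner, ← integral_complex_ofReal]
    congr 1
    ext h
    rw [← inner_conj_symm φ, RCLike.mul_conj]
    simp
  rw [hT0, inner_zero_right] at h2
  have h3 : (0 : ℝ) < ∫ h, ‖inner ℂ (π h φ) φ‖ ^ 2 ∂μ := by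
    apply Continuous.integral_pos_of_hasCompactSupport_nonneg_nonzero (x := 1)
    · fun_prop
    · exact .of_compactSpace _
    · intro h; positivity
    · simpa using hφ0
  exact h3.ne (by exact_mod_cast h2)

/-- A continuous unitary action of a compact group that moves a vector yields a
finite-dimensional unitary matrix representation in which the same element acts nontrivially. -/
theorem exists_unitaryGroup_rep_of_apply_ne {G H : Type*} [Group G]
    [TopologicalSpace G] [IsTopologicalGroup G] [CompactSpace G]
    [NormedAddCommGroup H] [InnerProductSpace ℂ H] [CompleteSpace H] (π : G →* (H →L[ℂ] H))
    (hπ : ∀ v, Continuous fun g => π g v)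
    (hinner : ∀ g v w, inner ℂ (π g v) (π g w) = inner ℂ v w) {g : G} {v : H}
    (hgv : π g v ≠ v) :
    ∃ (n : ℕ) (ρ : G →* Matrix (Fin n) (Fin n) ℂ), Continuous ρ ∧
      (∀ h, star (ρ h) * ρ h = 1) ∧ ρ g ≠ 1 := by
  obtain ⟨W, hW, hinv, w, hw, hgw⟩ := exists_finiteDimensional_invariant_of_apply_ne π hπ hinner hgv
  let b := stdOrthonormalBasis ℂ W
  let r : G →* (W →ₗ[ℂ] W) :=
    { toFun := fun h => (π h : H →ₗ[ℂ] H).restrict (hinv h)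
      map_one' := by ext; simp
      map_mul' := fun h k => by ext; simp }
  let ρ : G →* Matrix (Fin (Module.finrank ℂ W)) (Fin (Module.finrank ℂ W)) ℂ :=
    { toFun := fun h => LinearMap.toMatrix b.toBasis b.toBasis (r h)
      map_one' := by rw [map_one, LinearMap.toMatrix_one]
      map_mul' := fun h k => by rw [map_mul, LinearMap.toMatrix_mul] }
  have hentry : ∀ h i j, ρ h i j = inner ℂ (b i : H) (π h (b j)) := by
    intro h i j
    change LinearMap.toMatrix b.toBasis b.toBasis (r h) i j = _
    rw [LinearMap.toMatrix_apply]
    simp [OrthonormalBasis.repr_apply_apply, r]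
  have hstar : ∀ h, star (ρ h) = ρ h⁻¹ := by
    intro h
    ext i j
    rw [Matrix.star_apply, hentry, hentry, ← hinner h _ (π h⁻¹ _), ← mul_apply_eq_comp,
      ← map_mul, mul_inv_cancel, map_one, one_apply_eq_self]
    exact inner_conj_symm _ _
  refine ⟨_, ρ, ?_, fun h => by rw [hstar, ← map_mul, inv_mul_cancel, map_one], fun h => hgw ?_⟩
  · refine continuous_matrix fun i j => ?_
    simp_rw [hentry]
    exact continuous_const.inner (hπ _)
  · have h1 : r g = 1 := by
      apply (LinearMap.toMatrix b.toBasis b.toBasis).injective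
      rw [LinearMap.toMatrix_one]
      exact h
    exact congrArg Subtype.val (LinearMap.congr_fun h1 ⟨w, hw⟩)

open scoped ENNReal in
/-- **Peter–Weyl**: finite-dimensional unitary representations separate the points of a compact
Hausdorff group. -/
theorem exists_unitaryGroup_rep_ne_one {G : Type*} [Group G] [TopologicalSpace G]
    [IsTopologicalGroup G] [CompactSpace G] [T2Space G] {g : G} (hg : g ≠ 1) :
    ∃ (n : ℕ) (ρ : G →* Matrix (Fin n) (Fin n) ℂ), Continuous ρ ∧
      (∀ h, star (ρ h) * ρ h = 1) ∧ ρ g ≠ 1 := by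
  let _ : MeasurableSpace G := borel G
  have : BorelSpace G := ⟨rfl⟩
  let μ : Measure G := Measure.haarMeasure ⊤
  have : μ.Regular := Measure.regular_haarMeasure
  have : Fact ((2 : ℝ≥0∞) ≠ ∞) := ⟨ENNReal.ofNat_ne_top⟩
  let π : G →* (Lp ℂ 2 μ →L[ℂ] Lp ℂ 2 μ) :=
    { toFun := fun h => LinearMap.mkContinuous
        { toFun := fun f => DomMulAct.mk h⁻¹ • f
          map_add' := fun f f' => smul_add _ f f'
          map_smul' := fun c f => smul_comm _ c f } 1 (fun f => by
            simp [DomMulAct.norm_smul_Lp])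
      map_one' := by ext1 f; simp
      map_mul' := fun h k => by
        ext1 f
        simp [mul_smul] }
  have hπ : ∀ f h, π h f = DomMulAct.mk h⁻¹ • f := fun _ _ => rfl
  by_contra! hcon
  have key : ∀ f : Lp ℂ 2 μ, π g f = f := by
    intro f
    by_contra hne
    obtain ⟨n, ρ, h1, h2, h3⟩ := exists_unitaryGroup_rep_of_apply_ne π (fun f => by
      simp_rw [hπ]
      exact (DomMulAct.continuous_mk.comp continuous_inv).smul continuous_const) (fun h f f' => by
        have : ∀ x, ‖(π h : Lp ℂ 2 μ →ₗ[ℂ] Lp ℂ 2 μ) x‖ = ‖x‖ := fun x =>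
          DomMulAct.norm_smul_Lp _ _
        exact (LinearMap.norm_map_iff_inner_map_map (π h)).1 this f f') hne
    exact h3 (hcon n ρ h1 h2)
  obtain ⟨A, B, hA, hB, h1A, hgB, hAB⟩ := t2_separation hg.symm
  let U : Set G := A ∩ (g * ·) ⁻¹' B
  have hU : IsOpen U := hA.inter (hB.preimage (continuous_const_mul g))
  have h1U : (1 : G) ∈ U := ⟨h1A, by simpa using hgB⟩
  have h2 := key (indicatorConstLp 2 hU.measurableSet (measure_ne_top μ U) 1)
  rw [hπ, DomMulAct.mk_smul_indicatorConstLp] at h2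
  have h3 := (indicatorConstLp_inj _ _ _ _ one_ne_zero).1 h2
  have h4 : U ⊆ ((g⁻¹ • ·) ⁻¹' U)ᶜ := by
    rintro x hx ⟨-, hx'⟩
    exact Set.disjoint_left.1 hAB hx.1 (by simpa using hx')
  have h5 : μ U = 0 := by
    refine measure_mono_null ?_ (ae_le_set.1 h3.symm.le)
    exact fun x hx => ⟨hx, h4 hx⟩
  exact (hU.measure_pos μ ⟨1, h1U⟩).ne' h5
end PeterWeyl

section MatrixLie
open NormedSpace Filter

variable {𝔸 : Type*} [NormedRing 𝔸] [NormedAlgebra ℝ 𝔸] [CompleteSpace 𝔸]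

theorem NormedSpace.continuous_exp_real : Continuous (exp : 𝔸 → 𝔸) := by
  let _ := NormedAlgebra.restrictScalars ℚ ℝ 𝔸
  exact exp_continuous

theorem NormedSpace.exp_add_real {x y : 𝔸} (h : Commute x y) : exp (x + y) = exp x * exp y := by
  let _ := NormedAlgebra.restrictScalars ℚ ℝ 𝔸
  exact exp_add_of_commute h

theorem NormedSpace.exp_nsmul_real (n : ℕ) (x : 𝔸) : exp ((n : ℝ) • x) = exp x ^ n := by
  let _ := NormedAlgebra.restrictScalars ℚ ℝ 𝔸
  rw [← exp_nsmul, Nat.cast_smul_eq_nsmul]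

theorem NormedSpace.exp_neg_mul_real (x : 𝔸) : exp (-x) * exp x = 1 := by
  rw [← exp_add_real (Commute.refl x).neg_left, neg_add_cancel, exp_zero]

theorem NormedSpace.exp_mul_neg_real (x : 𝔸) : exp x * exp (-x) = 1 := by
  rw [← exp_add_real (Commute.refl x).neg_right, add_neg_cancel, exp_zero]

theorem NormedSpace.exp_conj_real {u v : 𝔸} (huv : u * v = 1) (hvu : v * u = 1) (x : 𝔸) :
    exp (u * x * v) = u * exp x * v := by
  let _ := NormedAlgebra.restrictScalars ℚ ℝ 𝔸
  exact exp_units_conj ⟨u, v, huv, hvu⟩ x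

theorem NormedSpace.hasDerivAt_exp_smul_zero (x : 𝔸) :
    HasDerivAt (fun t : ℝ => exp (t • x)) x 0 := by
  have h1 : HasFDerivAt (exp : 𝔸 → 𝔸) (1 : 𝔸 →L[ℝ] 𝔸) ((0 : ℝ) • x) := by
    rw [zero_smul]; exact hasFDerivAt_exp_zero
  have h2 : HasDerivAt (fun t : ℝ => t • x) ((1 : ℝ) • x) 0 := (hasDerivAt_id 0).smul_const x
  have h3 := h1.comp_hasDerivAt 0 h2
  simp only [one_smul, one_apply_eq_self] at h3
  exact h3

/-- The inverse of the exponential near the identity. -/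
noncomputable def expLocalHomeo (𝔸 : Type*) [NormedRing 𝔸] [NormedAlgebra ℝ 𝔸]
    [CompleteSpace 𝔸] : OpenPartialHomeomorph 𝔸 𝔸 :=
  HasStrictFDerivAt.toOpenPartialHomeomorph (f' := ContinuousLinearEquiv.refl ℝ 𝔸) (a := 0) exp
    hasStrictFDerivAt_exp_zero

theorem expLocalHomeo_coe : (expLocalHomeo 𝔸 : 𝔸 → 𝔸) = exp := rfl

theorem zero_mem_expLocalHomeo_source : (0 : 𝔸) ∈ (expLocalHomeo 𝔸).source :=
  HasStrictFDerivAt.mem_toOpenPartialHomeomorph_source _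

theorem one_mem_expLocalHomeo_target : (1 : 𝔸) ∈ (expLocalHomeo 𝔸).target := by
  have := (expLocalHomeo 𝔸).map_source zero_mem_expLocalHomeo_source
  rwa [expLocalHomeo_coe, exp_zero] at this

theorem expLocalHomeo_symm_one : (expLocalHomeo 𝔸).symm 1 = 0 := by
  have := (expLocalHomeo 𝔸).left_inv zero_mem_expLocalHomeo_source
  rwa [expLocalHomeo_coe, exp_zero] at this

theorem hasFDerivAt_expLocalHomeo_symm :
    HasFDerivAt (expLocalHomeo 𝔸).symm (1 : 𝔸 →L[ℝ] 𝔸) 1 := by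
  have := (HasStrictFDerivAt.to_localInverse (f := exp) (f' := ContinuousLinearEquiv.refl ℝ 𝔸)
    (a := 0) hasStrictFDerivAt_exp_zero).hasFDerivAt
  rw [exp_zero] at this
  exact this

/-- If small elements `Y i` exponentiate into a closed submonoid, so does every limit of
nonnegative rescalings. -/
theorem exp_smul_mem_of_tendsto {K : Submonoid 𝔸} (hK : IsClosed (K : Set 𝔸)) {ι : Type*}
    {l : Filter ι} [l.NeBot] {Y : ι → 𝔸} {c : ι → ℝ} {X : 𝔸} (hc : ∀ i, 0 ≤ c i)
    (hY : Tendsto Y l (𝓝 0)) (hcY : Tendsto (fun i => c i • Y i) l (𝓝 X))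
    (hmem : ∀ᶠ i in l, exp (Y i) ∈ K) {t : ℝ} (ht : 0 ≤ t) : exp (t • X) ∈ K := by
  have h1 : Tendsto (fun i => ((⌊t * c i⌋₊ : ℝ) - t * c i) • Y i) l (𝓝 0) := by
    refine squeeze_zero_norm (fun i => ?_) (by simpa using hY.norm)
    rw [norm_smul]
    refine mul_le_of_le_one_left (norm_nonneg _) ?_
    rw [Real.norm_eq_abs, abs_le]
    have h2 := Nat.floor_le (mul_nonneg ht (hc i))
    have h3 := Nat.lt_floor_add_one (t * c i)
    constructor <;> linarith
  have h2 : Tendsto (fun i => (⌊t * c i⌋₊ : ℝ) • Y i) l (𝓝 (t • X)) := by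
    have := h1.add (hcY.const_smul t)
    simp only [smul_smul, ← add_smul, sub_add_cancel, zero_add] at this
    exact this
  refine hK.mem_of_tendsto ((continuous_exp_real.tendsto _).comp h2) ?_
  filter_upwards [hmem] with i hi
  simp only [Function.comp, exp_nsmul_real]
  exact pow_mem hi _

/-- A closed submonoid closed under inverses contains the one-parameter group tangent to any
curve it contains. -/
theorem exp_smul_mem_of_hasDerivAt {K : Submonoid 𝔸} (hK : IsClosed (K : Set 𝔸))
    (hinv : ∀ x ∈ K, ∃ y ∈ K, y * x = 1) {γ : ℝ → 𝔸} {Z : 𝔸} (h0 : γ 0 = 1)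
    (hγ : HasDerivAt γ Z 0) (hmem : ∀ t, γ t ∈ K) (t : ℝ) : exp (t • Z) ∈ K := by
  have hpos : ∀ t : ℝ, 0 ≤ t → exp (t • Z) ∈ K := by
    intro t ht
    let y : ℝ → 𝔸 := fun s => (expLocalHomeo 𝔸).symm (γ s)
    have hy : HasDerivAt y Z 0 := by
      have h2 : HasFDerivAt (expLocalHomeo 𝔸).symm (1 : 𝔸 →L[ℝ] 𝔸) (γ 0) := by
        rw [h0]; exact hasFDerivAt_expLocalHomeo_symm
      exact h2.comp_hasDerivAt 0 hγ
    have hy0 : y 0 = 0 := by simp only [y, h0, expLocalHomeo_symm_one]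
    have hγ0 : Tendsto γ (𝓝 0) (𝓝 1) := by
      have := hγ.continuousAt.tendsto
      rwa [h0] at this
    have hev : ∀ᶠ s in 𝓝 (0 : ℝ), exp (y s) = γ s := by
      filter_upwards [hγ0.eventually ((expLocalHomeo 𝔸).open_target.mem_nhds
        one_mem_expLocalHomeo_target)] with s hs
      exact (expLocalHomeo 𝔸).right_inv hs
    have hy' : Tendsto (fun s => s⁻¹ • y s) (𝓝[>] 0) (𝓝 Z) := by
      have := hy.tendsto_slope_zero_right
      simpa [hy0] using this
    have hyc : Tendsto y (𝓝[>] 0) (𝓝 0) := by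
      have := hy.continuousAt.tendsto
      rw [hy0] at this
      exact this.mono_left nhdsWithin_le_nhds
    have hl : ∀ᶠ s in 𝓝[>] (0 : ℝ), 0 < s := eventually_mem_nhdsWithin
    refine exp_smul_mem_of_tendsto hK (l := 𝓝[>] (0 : ℝ)) (Y := y) (c := fun s => |s⁻¹|)
      (fun i => abs_nonneg _) hyc ?_ ?_ ht
    · refine hy'.congr' ?_
      filter_upwards [hl] with s hs
      rw [abs_of_pos (inv_pos.2 hs)]
    · filter_upwards [hev.filter_mono nhdsWithin_le_nhds] with s hs
      rw [hs]
      exact hmem s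
  rcases le_total 0 t with ht | ht
  · exact hpos t ht
  · obtain ⟨y, hy, hyx⟩ := hinv _ (hpos (-t) (neg_nonneg.2 ht))
    have : y = exp (t • Z) := by
      rw [← mul_one y, ← exp_neg_mul_real (t • Z), ← neg_smul, ← mul_assoc, hyx, one_mul]
    rwa [← this]

/-- The Lie algebra of a closed subgroup of the units of a Banach algebra. -/
noncomputable def Submonoid.expLie (K : Submonoid 𝔸) (hK : IsClosed (K : Set 𝔸))
    (hinv : ∀ x ∈ K, ∃ y ∈ K, y * x = 1) : Submodule ℝ 𝔸 where
  carrier := {X | ∀ t : ℝ, exp (t • X) ∈ K}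
  zero_mem' t := by simp [exp_zero]
  smul_mem' c X hX t := by rw [smul_smul]; exact hX _
  add_mem' {X Y} hX hY := by
    refine exp_smul_mem_of_hasDerivAt hK hinv (γ := fun t => exp (t • X) * exp (t • Y))
      (by simp [exp_zero]) ?_ fun t => mul_mem (hX t) (hY t)
    have := (hasDerivAt_exp_smul_zero X).mul (hasDerivAt_exp_smul_zero Y)
    simp only [zero_smul, exp_zero, mul_one, one_mul] at this
    exact this

variable [FiniteDimensional ℝ 𝔸]

/-- The exponential of arbitrarily small elements of the Lie algebra of a closed subgroup covers a
neighbourhood of the identity of the subgroup. -/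
theorem eventually_mem_exp_image {K : Submonoid 𝔸} (hK : IsClosed (K : Set 𝔸))
    (hinv : ∀ x ∈ K, ∃ y ∈ K, y * x = 1) {U : Set 𝔸} (hU : U ∈ 𝓝 0) :
    ∀ᶠ k in 𝓝 1, k ∈ K → ∃ X ∈ K.expLie hK hinv, X ∈ U ∧ exp X = k := by
  set L := K.expLie hK hinv
  obtain ⟨C, hC⟩ := L.exists_isCompl
  let Φ : L × C → 𝔸 := fun p => exp (p.1 : 𝔸) * exp (p.2 : 𝔸)
  let D : (L × C) ≃L[ℝ] 𝔸 := (L.prodEquivOfIsCompl C hC).toContinuousLinearEquiv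
  have hD : HasStrictFDerivAt Φ (D : (L × C) →L[ℝ] 𝔸) 0 := by
    have h1 : HasStrictFDerivAt (fun p : L × C => exp (p.1 : 𝔸))
        (L.subtypeL.comp (ContinuousLinearMap.fst ℝ L C)) 0 :=
      HasStrictFDerivAt.comp (g := exp) (g' := (1 : 𝔸 →L[ℝ] 𝔸)) (0 : L × C)
        hasStrictFDerivAt_exp_zero
        (L.subtypeL.comp (ContinuousLinearMap.fst ℝ L C)).hasStrictFDerivAt
    have h2 : HasStrictFDerivAt (fun p : L × C => exp (p.2 : 𝔸))
        (C.subtypeL.comp (ContinuousLinearMap.snd ℝ L C)) 0 :=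
      HasStrictFDerivAt.comp (g := exp) (g' := (1 : 𝔸 →L[ℝ] 𝔸)) (0 : L × C)
        hasStrictFDerivAt_exp_zero
        (C.subtypeL.comp (ContinuousLinearMap.snd ℝ L C)).hasStrictFDerivAt
    have h3 := h1.mul' h2
    have h4 : (D : (L × C) →L[ℝ] 𝔸) =
        exp (((0 : L × C).1 : L) : 𝔸) • C.subtypeL.comp (ContinuousLinearMap.snd ℝ L C) +
          MulOpposite.op (exp (((0 : L × C).2 : C) : 𝔸)) •
            L.subtypeL.comp (ContinuousLinearMap.fst ℝ L C) := by
      ext p <;> simp [D, exp_zero]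
    rw [h4]
    exact h3
  let F := hD.toOpenPartialHomeomorph Φ
  have hΦ0 : Φ 0 = 1 := by simp [Φ, exp_zero]
  have hFinv : Tendsto F.symm (𝓝 1) (𝓝 0) := by
    have := hD.localInverse_tendsto
    rwa [hΦ0] at this
  have hFr : ∀ᶠ k in 𝓝 (1 : 𝔸), Φ (F.symm k) = k := by
    have := hD.eventually_right_inverse
    rwa [hΦ0] at this
  by_contra hcon
  let l : Filter 𝔸 := 𝓝 1 ⊓ 𝓟 {k | ¬ (k ∈ K → ∃ X ∈ L, X ∈ U ∧ exp X = k)}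
  have hl : l.NeBot := frequently_iff_neBot.1 (not_eventually.1 hcon)
  let f : Ultrafilter 𝔸 := Ultrafilter.of l
  have hf1 : (f : Filter 𝔸) ≤ 𝓝 1 := (Ultrafilter.of_le l).trans inf_le_left
  have hf2 : ∀ᶠ k in (f : Filter 𝔸), ¬ (k ∈ K → ∃ X ∈ L, X ∈ U ∧ exp X = k) :=
    ((Ultrafilter.of_le l).trans inf_le_right) (mem_principal_self _)
  have hX : Tendsto (fun k => ((F.symm k).1 : 𝔸)) f (𝓝 0) :=
    ((continuous_subtype_val.comp continuous_fst).tendsto' (0 : L × C) 0 rfl).comp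
      (hFinv.mono_left hf1)
  let Y : 𝔸 → 𝔸 := fun k => ((F.symm k).2 : 𝔸)
  have hY : Tendsto Y f (𝓝 0) :=
    ((continuous_subtype_val.comp continuous_snd).tendsto' (0 : L × C) 0 rfl).comp
      (hFinv.mono_left hf1)
  have hYK : ∀ᶠ k in (f : Filter 𝔸), exp (Y k) ∈ K ∧ Y k ≠ 0 := by
    filter_upwards [hf2, hX.eventually hU, hFr.filter_mono hf1] with k hk hkU hkr
    push Not at hk
    have hX' : ∀ t : ℝ, exp (t • ((F.symm k).1 : 𝔸)) ∈ K := (F.symm k).1.2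
    have hkr' : exp ((F.symm k).1 : 𝔸) * exp (Y k) = k := hkr
    constructor
    · have h3 : exp (Y k) = exp (-((F.symm k).1 : 𝔸)) * k := by
        rw [← congrArg (exp (-((F.symm k).1 : 𝔸)) * ·) hkr']
        simp only [← mul_assoc, exp_neg_mul_real, one_mul]
      rw [h3]
      refine mul_mem ?_ hk.1
      simpa using hX' (-1)
    · intro h0
      rw [h0, exp_zero, mul_one] at hkr'
      exact hk.2 _ (F.symm k).1.2 hkU hkr'
  have hsph : ∀ᶠ k in (f : Filter 𝔸), ‖Y k‖⁻¹ • Y k ∈ Metric.sphere (0 : 𝔸) 1 := by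
    filter_upwards [hYK] with k hk
    rw [mem_sphere_zero_iff_norm, norm_smul, norm_inv, norm_norm,
      inv_mul_cancel₀ (norm_ne_zero_iff.2 hk.2)]
  have : ProperSpace 𝔸 := FiniteDimensional.proper_real 𝔸
  obtain ⟨Z, hZ, hZl⟩ := (isCompact_sphere (0 : 𝔸) 1).ultrafilter_le_nhds
    (f.map fun k => ‖Y k‖⁻¹ • Y k) (Filter.le_principal_iff.2 hsph)
  have hZlim : Tendsto (fun k => ‖Y k‖⁻¹ • Y k) f (𝓝 Z) := hZl
  have hZC : Z ∈ C := by
    refine C.closed_of_finiteDimensional.mem_of_tendsto hZlim (.of_forall fun k => ?_)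
    exact C.smul_mem _ (F.symm k).2.2
  have hZL : Z ∈ L := by
    have h4 : ∀ t : ℝ, 0 ≤ t → exp (t • Z) ∈ K := fun t ht =>
      exp_smul_mem_of_tendsto hK (fun _ => by positivity) hY hZlim (hYK.mono fun _ h => h.1) ht
    intro t
    rcases le_total 0 t with ht | ht
    · exact h4 t ht
    · obtain ⟨y, hy, hyx⟩ := hinv _ (h4 (-t) (neg_nonneg.2 ht))
      have : y = exp (t • Z) := by
        rw [← mul_one y, ← exp_neg_mul_real (t • Z), ← neg_smul, ← mul_assoc, hyx, one_mul]
      rwa [← this]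
  have : Z ∈ L ⊓ C := ⟨hZL, hZC⟩
  rw [hC.inf_eq_bot, Submodule.mem_bot] at this
  simp [this] at hZ

end MatrixLie

section RepLie
open NormedSpace Filter

theorem MonoidHom.isClosed_map_toSubmonoid {𝔸 G : Type*} [NormedRing 𝔸] [Group G]
    [TopologicalSpace G] [CompactSpace G] (ρ : G →* 𝔸) (hρ : Continuous ρ) {N : Subgroup G}
    (hN : IsClosed (N : Set G)) : IsClosed (N.toSubmonoid.map ρ : Set 𝔸) :=
  (hN.isCompact.image hρ).isClosed

theorem MonoidHom.exists_mul_eq_one_of_mem_map {𝔸 G : Type*} [Monoid 𝔸] [Group G] (ρ : G →* 𝔸)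
    (N : Subgroup G) :
    ∀ x ∈ N.toSubmonoid.map ρ, ∃ y ∈ N.toSubmonoid.map ρ, y * x = 1 := by
  rintro _ ⟨n, hn, rfl⟩
  exact ⟨ρ n⁻¹, ⟨n⁻¹, N.inv_mem hn, rfl⟩, by rw [← map_mul, inv_mul_cancel, map_one]⟩

variable {𝔸 : Type*} [NormedRing 𝔸] [NormedAlgebra ℝ 𝔸] [CompleteSpace 𝔸]
variable {G : Type*} [Group G] [TopologicalSpace G] [CompactSpace G]

/-- The Lie algebra of the image of a closed subgroup under a representation of a compact group. -/
noncomputable def MonoidHom.repLie (ρ : G →* 𝔸) (hρ : Continuous ρ) (N : Subgroup G)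
    (hN : IsClosed (N : Set G)) : Submodule ℝ 𝔸 :=
  (N.toSubmonoid.map ρ).expLie (ρ.isClosed_map_toSubmonoid hρ hN) (ρ.exists_mul_eq_one_of_mem_map N)

variable {ρ : G →* 𝔸} {hρ : Continuous ρ} {N N' : Subgroup G} {hN : IsClosed (N : Set G)}
  {hN' : IsClosed (N' : Set G)}

theorem MonoidHom.repLie_mono (h : N ≤ N') : ρ.repLie hρ N hN ≤ ρ.repLie hρ N' hN' := by
  intro X hX t
  obtain ⟨n, hn, h'⟩ := hX t
  exact ⟨n, h hn, h'⟩

theorem MonoidHom.conj_mem_repLie [N.Normal] {X : 𝔸} (hX : X ∈ ρ.repLie hρ N hN) (g : G) :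
    ρ g * X * ρ g⁻¹ ∈ ρ.repLie hρ N hN := by
  intro t
  obtain ⟨n, hn, h⟩ := hX t
  refine ⟨g * n * g⁻¹, ‹N.Normal›.conj_mem n hn g, ?_⟩
  rw [← smul_mul_assoc, ← mul_smul_comm, exp_conj_real (by simp [← map_mul]) (by simp [← map_mul])]
  simp only [map_mul, h]

variable [FiniteDimensional ℝ 𝔸]

theorem MonoidHom.eventually_exists_mem_repLie (ρ : G →* 𝔸) (hρ : Continuous ρ) (N : Subgroup G)
    (hN : IsClosed (N : Set G)) {U : Set 𝔸} (hU : U ∈ 𝓝 0) :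
    ∀ᶠ k in 𝓝 1, ∀ n ∈ N, ρ n = k → ∃ X ∈ ρ.repLie hρ N hN, X ∈ U ∧ exp X = k := by
  filter_upwards [eventually_mem_exp_image (ρ.isClosed_map_toSubmonoid hρ hN)
    (ρ.exists_mul_eq_one_of_mem_map N) hU] with k hk n hn hnk
  exact hk ⟨n, hn, hnk⟩

/-- A compact group with a faithful finite-dimensional representation is locally Euclidean. -/
theorem MonoidHom.exists_homeomorph_convex_of_injective [T2Space G] (ρ : G →* 𝔸)
    (hρ : Continuous ρ) (hinj : Function.Injective ρ) :
    ∃ (n : ℕ) (B : Set G) (V : Set (EuclideanSpace ℝ (Fin n))), IsOpen B ∧ 1 ∈ B ∧ IsOpen V ∧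
      Convex ℝ V ∧ Nonempty (B ≃ₜ V) := by
  have hcl : IsClosed ((⊤ : Subgroup G) : Set G) := isClosed_univ
  set L := ρ.repLie hρ ⊤ hcl with hL
  have hemb : IsClosedEmbedding ρ := hρ.isClosedEmbedding hinj
  let e := expLocalHomeo 𝔸
  obtain ⟨R, hR, hRs⟩ := Metric.mem_nhds_iff.1 (e.open_source.mem_nhds zero_mem_expLocalHomeo_source)
  have hW := ρ.eventually_exists_mem_repLie hρ ⊤ hcl (Metric.ball_mem_nhds 0 hR)
  have hW' : ∀ᶠ X in 𝓝 (0 : 𝔸), ∀ n ∈ (⊤ : Subgroup G), ρ n = exp X →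
      ∃ Y ∈ L, Y ∈ Metric.ball 0 R ∧ exp Y = exp X :=
    (continuous_exp_real.tendsto' 0 1 exp_zero).eventually hW
  obtain ⟨r', hr', hr's⟩ := Metric.mem_nhds_iff.1 hW'
  set r := min r' R
  have hr : 0 < r := lt_min hr' hR
  have hrs : Metric.ball (0 : 𝔸) r ⊆ e.source :=
    (Metric.ball_subset_ball (min_le_right _ _)).trans hRs
  have hO : IsOpen (e '' Metric.ball 0 r) := e.isOpen_image_of_subset_source Metric.isOpen_ball hrs
  let B : Set G := ρ ⁻¹' (e '' Metric.ball 0 r)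
  let V' : Set L := {X | (X : 𝔸) ∈ Metric.ball (0 : 𝔸) r}
  have hlog : ∀ b ∈ B, e.symm (ρ b) ∈ L ∧ e.symm (ρ b) ∈ Metric.ball (0 : 𝔸) r ∧
      exp (e.symm (ρ b)) = ρ b := by
    rintro b ⟨Z, hZ, hZb⟩
    have hZ1 : e.symm (ρ b) = Z := by rw [← hZb, e.left_inv (hrs hZ)]
    rw [hZ1]
    obtain ⟨Y, hY, hYR, hYZ⟩ := hr's (Metric.ball_subset_ball (min_le_left _ _) hZ) b trivial hZb.symm
    have : Y = Z := e.injOn (hRs hYR) (hrs hZ) hYZ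
    exact ⟨this ▸ hY, hZ, hZb⟩
  have hg : ∀ X : L, ∃ n : G, ρ n = exp (X : 𝔸) := by
    intro X
    obtain ⟨n, -, h⟩ := X.2 1
    exact ⟨n, by rw [h, one_smul]⟩
  choose g hg using hg
  have hgB : ∀ X ∈ V', g X ∈ B := fun X hX => ⟨X, hX, (hg X).symm⟩
  let H : B ≃ₜ V' :=
    { toFun := fun b => ⟨⟨e.symm (ρ b), (hlog b b.2).1⟩, (hlog b b.2).2.1⟩
      invFun := fun X => ⟨g X, hgB X X.2⟩
      left_inv := fun b => Subtype.ext (hinj (by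
        change ρ (g _) = ρ b
        rw [hg]
        exact (hlog b b.2).2.2))
      right_inv := fun X => by
        apply Subtype.ext
        apply Subtype.ext
        change e.symm (ρ (g X)) = (X : 𝔸)
        rw [hg]
        exact e.left_inv (hrs X.2)
      continuous_toFun := by
        refine Continuous.subtype_mk (Continuous.subtype_mk ?_ _) _
        refine e.symm.continuousOn.comp_continuous (hρ.comp continuous_subtype_val) fun b => ?_
        obtain ⟨Z, hZ, hZb⟩ := b.2
        exact hZb ▸ e.map_source (hrs hZ)
      continuous_invFun := by
        refine Continuous.subtype_mk ?_ _
        rw [hemb.continuous_iff]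
        have : (ρ ∘ fun X : V' => g X) = fun X : V' => exp ((X : L) : 𝔸) := by
          funext X; exact hg X
        rw [this]
        exact continuous_exp_real.comp (continuous_subtype_val.comp continuous_subtype_val) }
  let E : L ≃L[ℝ] EuclideanSpace ℝ (Fin (Module.finrank ℝ L)) := toEuclidean
  refine ⟨_, B, E '' V', hO.preimage hρ, ?_, ?_, ?_, ⟨H.trans (E.toHomeomorph.image V')⟩⟩
  · exact ⟨0, Metric.mem_ball_self hr, by rw [map_one]; exact exp_zero⟩
  · exact E.toHomeomorph.isOpenMap _ (Metric.isOpen_ball.preimage continuous_subtype_val)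
  · exact ((convex_ball (0 : 𝔸) r).linear_preimage L.subtype).linear_image
      (E : L →ₗ[ℝ] EuclideanSpace ℝ (Fin (Module.finrank ℝ L)))
end RepLie

section UnitaryRep
open NormedSpace Filter
open scoped Matrix Matrix.Norms.Operator

/-- A matrix whose real one-parameter group is unitary is skew-Hermitian. -/
theorem Matrix.conjTranspose_eq_neg_of_exp_unitary {n : ℕ} {X : Matrix (Fin n) (Fin n) ℂ}
    (h : ∀ t : ℝ, star (exp (t • X)) * exp (t • X) = 1) : Xᴴ = -X := by
  have key : (fun t : ℝ => exp (t • star X)) = fun t : ℝ => exp (t • (-X)) := by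
    funext t
    have h1 : exp (t • star X) = star (exp (t • X)) := by
      rw [star_exp, star_smul, star_trivial t]
    have h2 : exp (t • X) * exp (-(t • X)) = 1 := exp_mul_neg_real _
    calc exp (t • star X) = star (exp (t • X)) * (exp (t • X) * exp (-(t • X))) := by
          rw [h2, mul_one, h1]
      _ = exp (t • -X) := by rw [← mul_assoc, h, one_mul, smul_neg]
  have h1 : HasDerivAt (fun t : ℝ => exp (t • star X)) (star X) 0 := hasDerivAt_exp_smul_zero _
  rw [key] at h1
  exact h1.unique (hasDerivAt_exp_smul_zero (-X))

/-- A representation of a group without nontrivial circle characters has no central directions. -/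
theorem MonoidHom.eq_zero_of_exp_mem_of_commute {n : ℕ} {G : Type*} [Group G] [TopologicalSpace G]
    {ρ : G →* Matrix (Fin n) (Fin n) ℂ} (hρ : Continuous ρ) (hu : ∀ g, star (ρ g) * ρ g = 1)
    (hchar : ∀ χ : G →* Circle, Continuous χ → ∀ g, χ g = 1) {X : Matrix (Fin n) (Fin n) ℂ}
    (hX : ∀ t : ℝ, ∃ g, ρ g = exp (t • X)) (hcomm : ∀ g, ρ g * X = X * ρ g) : X = 0 := by
  have hskew : Xᴴ = -X := Matrix.conjTranspose_eq_neg_of_exp_unitary fun t => by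
    obtain ⟨g, hg⟩ := hX t
    rw [← hg, hu]
  have hH : (Complex.I • X).IsHermitian := by
    rw [Matrix.IsHermitian, Matrix.conjTranspose_smul, hskew]
    simp
  set U : Matrix (Fin n) (Fin n) ℂ := (hH.eigenvectorUnitary).1 with hU
  set d := hH.eigenvalues
  have hUU : star U * U = 1 := Unitary.coe_star_mul_self _
  have hUU' : U * star U = 1 := Unitary.coe_mul_star_self _
  have hD : star U * X * U = Matrix.diagonal fun i => -Complex.I * (d i : ℂ) := by
    have h1 := hH.conjStarAlgAut_star_eigenvectorUnitary
    rw [Unitary.conjStarAlgAut_star_apply] at h1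
    have h2 : star U * X * U = (-Complex.I) • (star U * (Complex.I • X) * U) := by
      rw [mul_smul_comm, smul_mul_assoc, smul_smul]; simp
    rw [h2]
    change (-Complex.I) • (star hH.eigenvectorUnitary.1 * _ * _) = _
    rw [h1, ← Matrix.diagonal_smul]
    rfl
  by_contra hX0
  obtain ⟨i₀, hi₀⟩ : ∃ i, d i ≠ 0 := by
    by_contra! hd
    apply hX0
    have : star U * X * U = 0 := by rw [hD]; simp [hd]
    calc X = (U * star U) * X * (U * star U) := by rw [hUU']; simp
      _ = U * (star U * X * U) * star U := by simp only [mul_assoc]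
      _ = 0 := by rw [this]; simp
  let σ : G → Matrix (Fin n) (Fin n) ℂ := fun g => star U * ρ g * U
  have hσmul : ∀ a b, σ (a * b) = σ a * σ b := by
    intro a b
    simp only [σ, map_mul]
    calc star U * (ρ a * ρ b) * U = star U * ρ a * 1 * ρ b * U := by simp [mul_assoc]
      _ = _ := by rw [← hUU']; simp only [mul_assoc]
  have hσ1 : σ 1 = 1 := by simp [σ, hUU]
  have hσu : ∀ g, star (σ g) * σ g = 1 := by
    intro g
    simp only [σ, star_mul, star_star]
    calc star U * (star (ρ g) * U) * (star U * ρ g * U)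
        = star U * star (ρ g) * (U * star U) * ρ g * U := by simp only [mul_assoc]
      _ = star U * (star (ρ g) * ρ g) * U := by rw [hUU']; simp only [mul_assoc, mul_one]
      _ = 1 := by rw [hu, mul_one, hUU]
  have hσexp : ∀ (t : ℝ) g, ρ g = exp (t • X) →
      σ g = Matrix.diagonal fun i => Complex.exp (-Complex.I * (t * d i : ℝ)) := by
    intro t g hg
    change star U * ρ g * U = _
    have h0 : exp (star U * (t • X) * U) = star U * exp (t • X) * U := exp_conj_real hUU hUU' _
    rw [hg, ← h0, mul_smul_comm, smul_mul_assoc, hD, ← Matrix.diagonal_smul,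
      Matrix.exp_diagonal]
    congr 1
    funext i
    rw [Pi.coe_exp, ← Complex.exp_eq_exp_ℂ]
    congr 1
    simp
    ring
  have hσD : ∀ g i j, d i ≠ d j → σ g i j = 0 := by
    intro g i j hij
    have h1 : σ g * (star U * X * U) = (star U * X * U) * σ g := by
      simp only [σ]
      calc star U * ρ g * U * (star U * X * U) = star U * ρ g * (U * star U) * X * U := by
            simp only [mul_assoc]
        _ = star U * (ρ g * X) * U := by rw [hUU']; simp only [mul_assoc, mul_one]
        _ = star U * X * (U * star U) * ρ g * U := by
            rw [hcomm, hUU']; simp only [mul_assoc, mul_one]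
        _ = _ := by simp only [mul_assoc]
    rw [hD] at h1
    have h2 := congrFun (congrFun h1 i) j
    rw [Matrix.mul_diagonal, Matrix.diagonal_mul] at h2
    have h3 : (Complex.I * ((d i : ℂ) - d j)) * σ g i j = 0 := by linear_combination h2
    refine (mul_eq_zero.1 h3).resolve_left (mul_ne_zero Complex.I_ne_zero (sub_ne_zero.2 ?_))
    exact_mod_cast hij
  let E : Matrix (Fin n) (Fin n) ℂ := Matrix.diagonal fun i => if d i = d i₀ then 1 else 0
  have hEE : E * E = E := by
    simp [E, Matrix.diagonal_mul_diagonal]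
  have hEs : star E = E := by
    rw [Matrix.star_eq_conjTranspose, Matrix.diagonal_conjTranspose]
    congr 1
    funext i
    simp only [Pi.star_apply]
    split_ifs <;> simp
  have hEσ : ∀ g, σ g * E = E * σ g := by
    intro g
    ext i j
    rw [Matrix.mul_diagonal, Matrix.diagonal_mul]
    by_cases hij : d i = d j
    · rw [hij, mul_comm]
    · rw [hσD g i j hij]; simp
  let τ : G → Matrix (Fin n) (Fin n) ℂ := fun g => 1 - E + σ g * E
  have hτmul : ∀ a b, τ (a * b) = τ a * τ b := by
    intro a b
    simp only [τ, hσmul]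
    have h1 : E * (σ b * E) = σ b * E := by rw [← mul_assoc, ← hEσ, mul_assoc, hEE]
    have h2 : σ a * E * (σ b * E) = σ a * σ b * E := by
      rw [mul_assoc (σ a) E, h1, ← mul_assoc]
    have h3 : σ a * E * E = σ a * E := by rw [mul_assoc, hEE]
    simp only [mul_add, add_mul, sub_mul, mul_sub, one_mul, mul_one, hEE, h1, h2, h3]
    abel
  have hτ1 : τ 1 = 1 := by simp [τ, hσ1]
  have hτu : ∀ g, star (τ g) * τ g = 1 := by
    intro g
    have h0 : star (σ g) * E = E * star (σ g) := by
      have := congrArg star (hEσ g)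
      simp only [star_mul, hEs] at this
      exact this.symm
    simp only [τ, star_add, star_sub, star_one, star_mul, hEs]
    have h1 : E * (σ g * E) = σ g * E := by rw [← mul_assoc, ← hEσ, mul_assoc, hEE]
    have h2 : E * star (σ g) * (σ g * E) = E := by
      calc E * star (σ g) * (σ g * E) = E * (star (σ g) * σ g) * E := by simp only [mul_assoc]
        _ = E := by rw [hσu, mul_one, hEE]
    have h3 : E * star (σ g) * E = E * star (σ g) := by rw [mul_assoc, h0, ← mul_assoc, hEE]
    simp only [mul_add, add_mul, sub_mul, mul_sub, one_mul, mul_one, hEE, h1, h2, h3]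
    abel
  have hdet : ∀ g, ‖(τ g).det‖ = 1 := by
    intro g
    have h1 := congrArg Matrix.det (hτu g)
    rw [Matrix.det_mul, Matrix.det_one, Matrix.star_eq_conjTranspose, Matrix.det_conjTranspose] at h1
    have h2 := congrArg norm h1
    rw [norm_mul, norm_star, norm_one] at h2
    nlinarith [norm_nonneg (τ g).det]
  let χ : G →* Circle :=
    { toFun := fun g => ⟨(τ g).det, by simp [Submonoid.unitSphere, hdet]⟩
      map_one' := by ext; simp [hτ1]
      map_mul' := fun a b => Subtype.ext (by
        change (τ (a * b)).det = (τ a).det * (τ b).det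
        rw [hτmul, Matrix.det_mul]) }
  have hχ : Continuous χ := by
    refine Continuous.subtype_mk ?_ _
    have : Continuous τ := by fun_prop
    exact this.matrix_det
  set k := (Finset.univ.filter fun i => d i = d i₀).card with hk
  have hk0 : (k : ℝ) ≠ 0 := by
    rw [Nat.cast_ne_zero, hk, Finset.card_ne_zero]
    exact ⟨i₀, by simp⟩
  set t : ℝ := Real.pi / (k * d i₀)
  obtain ⟨g, hg⟩ := hX t
  have h1 : (τ g).det = 1 := congrArg Subtype.val (hchar χ hχ g)
  have h2 : τ g = Matrix.diagonal fun i =>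
      if d i = d i₀ then Complex.exp (-Complex.I * (t * d i₀ : ℝ)) else 1 := by
    simp only [τ, E, hσexp t g hg]
    rw [Matrix.diagonal_mul_diagonal, ← Matrix.diagonal_one, Matrix.diagonal_sub,
      Matrix.diagonal_add]
    congr 1
    funext i
    split_ifs with h
    · simp [h]
    · simp
  rw [h2, Matrix.det_diagonal, Finset.prod_ite, Finset.prod_const, Finset.prod_const_one, mul_one,
    ← hk, ← Complex.exp_nat_mul] at h1
  have h3 : (k : ℂ) * (-Complex.I * (t * d i₀ : ℝ)) = -(Real.pi * Complex.I) := by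
    have : (k : ℝ) * (t * d i₀) = Real.pi := by
      simp only [t]; field_simp
    rw [← this]; push_cast; ring
  rw [h3, Complex.exp_neg, Complex.exp_pi_mul_I] at h1
  norm_num at h1
end UnitaryRep

/-- The centralizer in `G` of a set of matrices. -/
def MonoidHom.centralizerOf {𝔸 G : Type*} [Ring 𝔸] [Group G] (ρ : G →* 𝔸)
    (V : Set 𝔸) : Subgroup G where
  carrier := {g | ∀ X ∈ V, ρ g * X = X * ρ g}
  one_mem' := by simp
  mul_mem' {a b} ha hb X hX := by
    rw [map_mul, mul_assoc, hb X hX, ← mul_assoc, ha X hX, mul_assoc]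
  inv_mem' {a} ha X hX := by
    have h := ha X hX
    have h1 : ρ a⁻¹ * ρ a = 1 := by rw [← map_mul]; simp
    have h2 : ρ a * ρ a⁻¹ = 1 := by rw [← map_mul]; simp
    calc ρ a⁻¹ * X = ρ a⁻¹ * (X * ρ a) * ρ a⁻¹ := by rw [mul_assoc, mul_assoc, h2, mul_one]
      _ = ρ a⁻¹ * ρ a * X * ρ a⁻¹ := by rw [← h]; simp only [mul_assoc]
      _ = X * ρ a⁻¹ := by rw [h1, one_mul]

section RepLieGroup
open NormedSpace Filter

theorem commute_exp_smul_of_commute {𝔸 : Type*} [NormedRing 𝔸] [NormedAlgebra ℝ 𝔸] {X Y : 𝔸}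
    (h : Y * X = X * Y) (t : ℝ) :
    exp (t • Y) * X = X * exp (t • Y) := by
  let _ : NormedAlgebra ℚ 𝔸 := NormedAlgebra.restrictScalars ℚ ℝ 𝔸
  have h1 : Commute (t • Y) X := Commute.smul_left h t
  exact h1.exp_left.eq

variable {𝔸 : Type*} [NormedRing 𝔸] [NormedAlgebra ℝ 𝔸] [CompleteSpace 𝔸]
variable {G : Type*} [Group G] [TopologicalSpace G] [CompactSpace G]
variable {ρ : G →* 𝔸} {hρ : Continuous ρ} {N : Subgroup G} {hN : IsClosed (N : Set G)}

theorem hasDerivAt_exp_smul_conj (Y X : 𝔸) :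
    HasDerivAt (fun t : ℝ => exp (t • Y) * X * exp (t • -Y)) (Y * X - X * Y) 0 := by
  have h := ((hasDerivAt_exp_smul_zero Y).mul_const X).mul (hasDerivAt_exp_smul_zero (-Y))
  have e : Y * X * exp ((0 : ℝ) • -Y) + exp ((0 : ℝ) • Y) * X * -Y = Y * X - X * Y := by
    simp [exp_zero, sub_eq_add_neg]
  exact e ▸ h

theorem Submodule.bracket_mem_of_exp_conj_mem {V : Submodule ℝ 𝔸} (hV : IsClosed (V : Set 𝔸))
    {X Y : 𝔸} (h : ∀ t : ℝ, exp (t • Y) * X * exp (t • -Y) ∈ V) : Y * X - X * Y ∈ V := by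
  have hd := (hasDerivAt_iff_tendsto_slope.1 (hasDerivAt_exp_smul_conj Y X))
  refine hV.mem_of_tendsto hd (Eventually.of_forall fun t => ?_)
  exact V.smul_mem _ (V.sub_mem (h t) (h 0))

theorem commute_of_commute_exp_smul {X Y : 𝔸} (h : ∀ t : ℝ, exp (t • Y) * X = X * exp (t • Y)) :
    Y * X = X * Y := by
  have h0 : (fun t : ℝ => exp (t • Y) * X) = fun t : ℝ => X * exp (t • Y) := funext h
  have h1 := (hasDerivAt_exp_smul_zero Y).mul_const X
  have h2 := (hasDerivAt_exp_smul_zero Y).const_mul X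
  rw [h0] at h1
  exact h1.unique h2

variable [FiniteDimensional ℝ 𝔸]

/-- A closed subgroup of a connected group containing the kernel of a representation and with the
full Lie algebra is the whole group. -/
theorem MonoidHom.eq_top_of_repLie_le [IsTopologicalGroup G] [PreconnectedSpace G]
    {ρ : G →* 𝔸} {hρ : Continuous ρ} {h1 : IsClosed ((⊤ : Subgroup G) : Set G)}
    (h : ρ.repLie hρ ⊤ h1 ≤ ρ.repLie hρ N hN) (hker : ∀ g, ρ g = 1 → g ∈ N) : N = ⊤ := by
  have hmem : (N : Set G) ∈ 𝓝 1 := by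
    have h2 := ρ.eventually_exists_mem_repLie hρ ⊤ h1 (U := Set.univ) univ_mem
    have h3 : Tendsto ρ (𝓝 1) (𝓝 1) := hρ.tendsto' _ _ (map_one ρ)
    filter_upwards [h3.eventually h2] with g hg
    obtain ⟨X, hX, -, hXg⟩ := hg g trivial rfl
    obtain ⟨n, hn, hn'⟩ := h hX 1
    rw [one_smul, hXg] at hn'
    have : g * n⁻¹ ∈ N := hker _ (by rw [map_mul, ← hn', ← map_mul, mul_inv_cancel, map_one])
    simpa using N.mul_mem this hn
  have ho : IsOpen (N : Set G) := N.isOpen_of_mem_nhds hmem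
  have := (isClopen_iff.1 ⟨hN, ho⟩).resolve_left (OneMemClass.coe_nonempty N).ne_empty
  exact SetLike.coe_injective this

end RepLieGroup

section UnitaryRepLie
open NormedSpace Filter
open scoped Matrix Matrix.Norms.Operator ComplexOrder

/-- The real trace form on complex matrices. -/
noncomputable def Matrix.reTraceForm (n : ℕ) : LinearMap.BilinForm ℝ (Matrix (Fin n) (Fin n) ℂ) :=
  LinearMap.mk₂ ℝ (fun X Y => (X * Y).trace.re) (fun X Y Z => by simp [add_mul])
    (fun c X Y => by simp) (fun X Y Z => by simp [mul_add]) (fun c X Y => by simp)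

theorem Matrix.reTraceForm_apply {n : ℕ} (X Y : Matrix (Fin n) (Fin n) ℂ) :
    Matrix.reTraceForm n X Y = (X * Y).trace.re := rfl

theorem Matrix.eq_zero_of_reTraceForm_self {n : ℕ} {X : Matrix (Fin n) (Fin n) ℂ} (hX : Xᴴ = -X)
    (h : Matrix.reTraceForm n X X = 0) : X = 0 := by
  rw [← Matrix.trace_conjTranspose_mul_self_eq_zero_iff, hX]
  have him : star (X * X).trace = (X * X).trace := by
    rw [← Matrix.trace_conjTranspose, Matrix.conjTranspose_mul, hX, neg_mul_neg]
  have h1 : (X * X).trace = 0 := by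
    apply Complex.ext
    · exact h
    · exact Complex.conj_eq_iff_im.1 him
  rw [neg_mul, Matrix.trace_neg, h1, neg_zero]

variable {n : ℕ} {G : Type*} [Group G] [TopologicalSpace G] [CompactSpace G]
  {ρ : G →* Matrix (Fin n) (Fin n) ℂ} {hρ : Continuous ρ} {N : Subgroup G}
  {hN : IsClosed (N : Set G)} 

theorem MonoidHom.conjTranspose_eq_neg_of_mem_repLie (hu : ∀ g, star (ρ g) * ρ g = 1)
    {X : Matrix (Fin n) (Fin n) ℂ} (hX : X ∈ ρ.repLie hρ N hN) : Xᴴ = -X :=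
  Matrix.conjTranspose_eq_neg_of_exp_unitary fun t => by
    obtain ⟨g, -, hg⟩ : ∃ g ∈ N, ρ g = exp (t • X) := hX t
    rw [← hg, hu]

/-- Decomposition of the Lie algebra with respect to an ideal and its centralizer. -/
theorem MonoidHom.exists_sub_commute_of_mem_repLie (hu : ∀ g, star (ρ g) * ρ g = 1)
    {V : Submodule ℝ (Matrix (Fin n) (Fin n) ℂ)} (hV : V ≤ ρ.repLie hρ N hN)
    (hinv : ∀ g ∈ N, ∀ X ∈ V, ρ g * X * ρ g⁻¹ ∈ V) {Y : Matrix (Fin n) (Fin n) ℂ}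
    (hY : Y ∈ ρ.repLie hρ N hN) :
    ∃ Z ∈ V, ∀ X ∈ V, (Y - Z) * X = X * (Y - Z) := by
  have hskew : ∀ X ∈ V, Xᴴ = -X := fun X hX => conjTranspose_eq_neg_of_mem_repLie hu (hV hX)
  have hbr : ∀ W ∈ ρ.repLie hρ N hN, ∀ X ∈ V, W * X - X * W ∈ V := by
    intro W hW X hX
    refine Submodule.bracket_mem_of_exp_conj_mem V.closed_of_finiteDimensional fun t => ?_
    obtain ⟨g, hg, hg'⟩ : ∃ g ∈ N, ρ g = exp (t • W) := hW t
    have h2 : ρ g⁻¹ = exp (t • -W) := by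
      have h3 : exp (t • W) * exp (-(t • W)) = 1 := exp_mul_neg_real _
      have h4 : ρ g⁻¹ * ρ g = 1 := by rw [← map_mul]; simp
      calc ρ g⁻¹ = ρ g⁻¹ * (exp (t • W) * exp (-(t • W))) := by rw [h3, mul_one]
        _ = _ := by rw [← hg', ← mul_assoc, h4, one_mul, smul_neg]
    have := hinv g hg X hX
    rw [hg', h2] at this
    exact this
  have hrefl : (Matrix.reTraceForm n).IsSymm := ⟨fun X Y => by
    simp only [Matrix.reTraceForm_apply]
    rw [Matrix.trace_mul_comm]⟩
  have hnd : ((Matrix.reTraceForm n).restrict V).Nondegenerate := by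
    refine ⟨fun X hX => ?_, fun X hX => ?_⟩ <;>
    exact Subtype.ext (Matrix.eq_zero_of_reTraceForm_self (hskew X X.2) (hX X))
  have hc := LinearMap.BilinForm.isCompl_orthogonal_of_restrict_nondegenerate hrefl.isRefl hnd
  obtain ⟨Z, hZ, Y', hY', rfl⟩ := Submodule.mem_sup.1 (hc.sup_eq_top ▸ Submodule.mem_top (x := Y))
  have hY'L : Y' ∈ ρ.repLie hρ N hN := by
    simpa using Submodule.sub_mem _ hY (hV hZ)
  refine ⟨Z, hZ, fun X hX => ?_⟩
  rw [add_sub_cancel_left, ← sub_eq_zero]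
  refine Matrix.eq_zero_of_reTraceForm_self (hskew _ (hbr _ hY'L X hX)) ?_
  set W := Y' * X - X * Y' with hW
  have hWV : W ∈ V := hbr _ hY'L X hX
  have h1 : Matrix.reTraceForm n (X * W - W * X) Y' = 0 := hY' _ (hbr _ (hV hX) _ hWV)
  rw [Matrix.reTraceForm_apply] at h1 ⊢
  have h2 : ((X * W - W * X) * Y').trace = (W * W).trace := by
    have e1 : (X * W * Y').trace = (Y' * X * W).trace := by
      rw [Matrix.trace_mul_comm, mul_assoc]
    have e2 : (W * X * Y').trace = (X * Y' * W).trace := by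
      rw [mul_assoc, Matrix.trace_mul_comm]
    calc _ = (Y' * X * W).trace - (X * Y' * W).trace := by rw [sub_mul, Matrix.trace_sub, e1, e2]
      _ = _ := by rw [← Matrix.trace_sub, ← sub_mul]
  rw [← h2, h1]
end UnitaryRepLie

/-- A maximal proper closed normal subgroup of a topological group. -/
structure Subgroup.IsMaxClosedNormal {G : Type*} [Group G] [TopologicalSpace G]
    (M : Subgroup G) : Prop where
  normal : M.Normal
  isClosed : IsClosed (M : Set G)
  ne_top : M ≠ ⊤
  eq_of_le : ∀ M' : Subgroup G, M'.Normal → IsClosed (M' : Set G) → M ≤ M' → M' ≠ ⊤ → M' = M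

section Perfect
open NormedSpace Filter
open scoped Matrix Matrix.Norms.Operator

variable {G : Type*} [Group G] [TopologicalSpace G] [IsTopologicalGroup G] [CompactSpace G]
  [PreconnectedSpace G]

/-- A compact connected group without nontrivial circle characters has no nontrivial
commutative Hausdorff quotients. -/
theorem Subgroup.eq_top_of_commutator_mem
    (hchar : ∀ χ : G →* Circle, Continuous χ → ∀ g, χ g = 1) (N : Subgroup G) [N.Normal]
    (hN : IsClosed (N : Set G)) (hcomm : ∀ a b, a * b * a⁻¹ * b⁻¹ ∈ N) : N = ⊤ := by
  by_contra hne
  obtain ⟨g, hg⟩ : ∃ g, g ∉ N := by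
    by_contra! h
    exact hne ((Subgroup.eq_top_iff' N).2 h)
  have : IsClosed (N : Set G) := hN
  obtain ⟨n, ρ, hρ, hu, hρg⟩ := exists_unitaryGroup_rep_ne_one
    (g := (QuotientGroup.mk' N g)) (by simpa using hg)
  let σ : G →* Matrix (Fin n) (Fin n) ℂ := ρ.comp (QuotientGroup.mk' N)
  have hσ : Continuous σ := hρ.comp continuous_quot_mk
  have hσu : ∀ g, star (σ g) * σ g = 1 := fun g => hu _
  have hσN : ∀ a ∈ N, σ a = 1 := by
    intro a ha
    have : QuotientGroup.mk' N a = 1 := (QuotientGroup.eq_one_iff a).2 ha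
    rw [MonoidHom.comp_apply, this, map_one]
  have hσc : ∀ a b, σ a * σ b = σ b * σ a := by
    intro a b
    have h1 := hσN _ (hcomm a b)
    calc σ a * σ b = σ ((a * b * a⁻¹ * b⁻¹) * (b * a)) := by
          rw [← map_mul]; congr 1; group
      _ = σ b * σ a := by rw [map_mul, h1, one_mul, map_mul]
  have hker : IsClosed (σ.ker : Set G) := (isClosed_singleton (x := 1)).preimage hσ
  have htop : σ.ker = ⊤ := by
    refine MonoidHom.eq_top_of_repLie_le (hρ := hσ) (hN := hker) (h1 := isClosed_univ)
      (fun X hX => ?_) fun g hg => hg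
    have hX' : ∀ t : ℝ, ∃ g, σ g = exp (t • X) := fun t => by
      obtain ⟨g, -, hg⟩ := hX t
      exact ⟨g, hg⟩
    have hX0 : X = 0 := by
      refine MonoidHom.eq_zero_of_exp_mem_of_commute hσ hσu hchar hX' fun g => ?_
      refine (commute_of_commute_exp_smul (Y := X) (X := σ g) fun t => ?_).symm
      obtain ⟨h, -, hh⟩ := hX t
      exact hh ▸ hσc h g
    rw [hX0]
    exact Submodule.zero_mem _
  have : g ∈ σ.ker := htop ▸ Subgroup.mem_top g
  exact hρg this

theorem Subgroup.exists_isMaxClosedNormal_of_rep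
    (hchar : ∀ χ : G →* Circle, Continuous χ → ∀ g, χ g = 1) {n : ℕ}
    {ρ : G →* Matrix (Fin n) (Fin n) ℂ} (hρ : Continuous ρ) (hu : ∀ g, star (ρ g) * ρ g = 1)
    (N : Subgroup G) [N.Normal] (hN : IsClosed (N : Set G)) (hNc : IsPreconnected (N : Set G))
    {n₀ : G} (hn₀ : n₀ ∈ N) (hρn₀ : ρ n₀ ≠ 1) :
    ∃ M : Subgroup G, M.IsMaxClosedNormal ∧ ¬ N ≤ M := by
  have htopc : IsClosed ((⊤ : Subgroup G) : Set G) := isClosed_univ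
  have hNbot : ρ.repLie hρ N hN ≠ ⊥ := by
    intro hbot
    have : CompactSpace N := isCompact_iff_compactSpace.1 hN.isCompact
    have : PreconnectedSpace N := Subtype.preconnectedSpace hNc
    let σ : N →* Matrix (Fin n) (Fin n) ℂ := ρ.comp N.subtype
    have hσ : Continuous σ := hρ.comp continuous_subtype_val
    have hker : IsClosed (σ.ker : Set N) := (isClosed_singleton (x := 1)).preimage hσ
    have htop : σ.ker = ⊤ := by
      refine MonoidHom.eq_top_of_repLie_le (hρ := hσ) (hN := hker) (h1 := isClosed_univ)
        (fun X hX => ?_) fun g hg => hg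
      have hX0 : X ∈ ρ.repLie hρ N hN := fun t => by
        obtain ⟨g, -, hg⟩ := hX t
        exact ⟨g, g.2, hg⟩
      rw [hbot, Submodule.mem_bot] at hX0
      rw [hX0]
      exact Submodule.zero_mem _
    have : (⟨n₀, hn₀⟩ : N) ∈ σ.ker := htop ▸ Subgroup.mem_top _
    exact hρn₀ this
  let S : Set (Submodule ℝ (Matrix (Fin n) (Fin n) ℂ)) :=
    {V | V ≠ ⊥ ∧ V ≤ ρ.repLie hρ N hN ∧ ∀ g, ∀ X ∈ V, ρ g * X * ρ g⁻¹ ∈ V}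
  obtain ⟨V, ⟨hV0, hVN, hVinv⟩, hVmin⟩ := WellFounded.has_min (r := (· < ·)) wellFounded_lt S
    ⟨ρ.repLie hρ N hN, hNbot, le_rfl, fun g X hX => MonoidHom.conj_mem_repLie hX g⟩
  have hVtop : V ≤ ρ.repLie hρ ⊤ htopc := hVN.trans (MonoidHom.repLie_mono le_top)
  have hcancel : ∀ g, ρ g⁻¹ * ρ g = 1 := fun g => by rw [← map_mul]; simp
  have hcancel' : ∀ g, ρ g * ρ g⁻¹ = 1 := fun g => by rw [← map_mul]; simp
  let M := ρ.centralizerOf (V : Set (Matrix (Fin n) (Fin n) ℂ))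
  have hMmem : ∀ g, g ∈ M ↔ ∀ X ∈ V, ρ g * X = X * ρ g := fun g => Iff.rfl
  have hMn : M.Normal := ⟨fun m hm g => by
    rw [hMmem] at hm ⊢
    intro X hX
    have h1 := hm _ (hVinv g⁻¹ X hX)
    rw [inv_inv] at h1
    simp only [map_mul]
    calc ρ g * ρ m * ρ g⁻¹ * X = ρ g * (ρ m * (ρ g⁻¹ * X * ρ g)) * ρ g⁻¹ := by
          simp only [mul_assoc, hcancel', mul_one]
      _ = (ρ g * ρ g⁻¹) * X * ρ g * ρ m * ρ g⁻¹ := by rw [h1]; simp only [mul_assoc]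
      _ = X * (ρ g * ρ m * ρ g⁻¹) := by rw [hcancel', one_mul]; simp only [mul_assoc]⟩
  have hMc : IsClosed (M : Set G) := by
    have : (M : Set G) = ⋂ X ∈ V, {g | ρ g * X = X * ρ g} := by
      ext g; simp [hMmem]
    rw [this]
    exact isClosed_biInter fun X _ =>
      isClosed_eq (hρ.mul continuous_const) (continuous_const.mul hρ)
  have hMt : M ≠ ⊤ := by
    intro htop
    apply hV0
    rw [Submodule.eq_bot_iff]
    intro X hX
    refine MonoidHom.eq_zero_of_exp_mem_of_commute hρ hu hchar (fun t => ?_) fun g => ?_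
    · obtain ⟨g, -, hg⟩ := hVtop hX t
      exact ⟨g, hg⟩
    · exact (hMmem g).1 (htop ▸ Subgroup.mem_top g) X hX
  have hkerM : ∀ g, ρ g = 1 → g ∈ M := fun g hg => (hMmem g).2 fun X _ => by simp [hg]
  -- `Lie G` is spanned by `V` and `Lie M`.
  have hdecomp : ∀ Y ∈ ρ.repLie hρ ⊤ htopc, ∃ Z ∈ V, Y - Z ∈ ρ.repLie hρ M hMc := by
    intro Y hY
    obtain ⟨Z, hZ, hc⟩ := MonoidHom.exists_sub_commute_of_mem_repLie hu hVtop
      (fun g _ => hVinv g) hY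
    refine ⟨Z, hZ, fun t => ?_⟩
    obtain ⟨g, -, hg⟩ := Submodule.sub_mem _ hY (hVtop hZ) t
    refine ⟨g, (hMmem g).2 fun X hX => ?_, hg⟩
    rw [hg]
    exact commute_exp_smul_of_commute (hc X hX) t
  have hfull : ∀ (M' : Subgroup G) (hM' : IsClosed (M' : Set G)), M ≤ M' →
      V ≤ ρ.repLie hρ M' hM' → M' = ⊤ := by
    intro M' hM' hle hVM'
    refine MonoidHom.eq_top_of_repLie_le (hρ := hρ) (hN := hM') (h1 := htopc)
      (fun Y hY => ?_) fun g hg => hle (hkerM g hg)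
    obtain ⟨Z, hZ, hYZ⟩ := hdecomp Y hY
    simpa using Submodule.add_mem _ (MonoidHom.repLie_mono (hN' := hM') hle hYZ) (hVM' hZ)
  refine ⟨M, ⟨hMn, hMc, hMt, fun M' hM'n hM'c hle hM't => ?_⟩, fun hNM => hMt ?_⟩
  · refine le_antisymm (fun m hm => (hMmem m).2 fun X hX => ?_) hle
    have hbot : ρ.repLie hρ M' hM'c ⊓ V = ⊥ := by
      by_contra hne
      have h1 := hVmin _ (show ρ.repLie hρ M' hM'c ⊓ V ∈ S from
        ⟨hne, inf_le_right.trans hVN, fun g X hX =>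
          ⟨MonoidHom.conj_mem_repLie hX.1 g, hVinv g X hX.2⟩⟩)
      refine hM't (hfull M' hM'c hle ?_)
      exact inf_eq_right.1 ((inf_le_right (a := ρ.repLie hρ M' hM'c) (b := V)).eq_of_not_lt h1)
    have hZ : ρ m * X * ρ m⁻¹ - X ∈ ρ.repLie hρ M' hM'c ⊓ V := by
      refine ⟨?_, V.sub_mem (hVinv m X hX) hX⟩
      have hd : HasDerivAt (fun t : ℝ => ρ m * exp (t • X) * ρ m⁻¹ * exp (t • -X))
          (ρ m * X * ρ m⁻¹ - X) 0 := by
        have h := (((hasDerivAt_exp_smul_zero X).const_mul (ρ m)).mul_const (ρ m⁻¹)).mul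
          (hasDerivAt_exp_smul_zero (-X))
        have e : ρ m * X * ρ m⁻¹ * exp ((0 : ℝ) • -X) + ρ m * exp ((0 : ℝ) • X) * ρ m⁻¹ * -X =
            ρ m * X * ρ m⁻¹ - X := by
          simp [exp_zero, sub_eq_add_neg, hcancel']
        exact e ▸ h
      refine exp_smul_mem_of_hasDerivAt (ρ.isClosed_map_toSubmonoid hρ hM'c)
        (ρ.exists_mul_eq_one_of_mem_map M') ?_ hd fun t => ?_
      · simp [exp_zero, hcancel']
      · obtain ⟨g, -, hg⟩ : ∃ g ∈ (⊤ : Subgroup G), ρ g = exp (t • X) := hVtop hX t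
        refine ⟨m * (g * m⁻¹ * g⁻¹), M'.mul_mem hm (hM'n.conj_mem _ (M'.inv_mem hm) g), ?_⟩
        have h3 : exp (t • X) * exp (-(t • X)) = 1 := exp_mul_neg_real _
        have h4 : ρ g⁻¹ = exp (t • -X) := by
          calc ρ g⁻¹ = ρ g⁻¹ * (exp (t • X) * exp (-(t • X))) := by rw [h3, mul_one]
            _ = _ := by rw [← hg, ← mul_assoc, hcancel, one_mul, smul_neg]
        simp only [map_mul, hg, h4, mul_assoc]
    rw [hbot, Submodule.mem_bot, sub_eq_zero] at hZ
    calc ρ m * X = ρ m * X * (ρ m⁻¹ * ρ m) := by rw [hcancel, mul_one]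
      _ = X * ρ m := by rw [← mul_assoc, hZ]
  · exact hfull M hMc le_rfl (hVN.trans (MonoidHom.repLie_mono hNM))
end Perfect

theorem totallyDisconnectedSpace_of_injective {X Y : Type*} [TopologicalSpace X]
    [TopologicalSpace Y] [TotallyDisconnectedSpace Y] {f : X → Y} (hf : Continuous f)
    (hinj : Function.Injective f) : TotallyDisconnectedSpace X :=
  ⟨isTotallyDisconnected_of_image hf.continuousOn hinj
    (isTotallyDisconnected_of_totallyDisconnectedSpace _)⟩

theorem Subgroup.exists_mul_eq_of_sup_eq_top {G : Type*} [Group G] {A B : Subgroup G} [B.Normal]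
    (h : A ⊔ B = ⊤)
    (g : G) : ∃ a ∈ A, ∃ b ∈ B, a * b = g :=
  Subgroup.mem_sup_of_normal_right.1 (h ▸ Subgroup.mem_top g)

theorem Subgroup.mul_mul_inv_mul_inv_mem_of_sup_eq_top {G : Type*} [Group G] {A B M K : Subgroup G}
    [M.Normal]
    [K.Normal] (hA : A ⊔ M = ⊤) (hB : B ⊔ M = ⊤) (hMK : M ≤ K)
    (hc : ∀ a ∈ A, ∀ b ∈ B, a * b * a⁻¹ * b⁻¹ ∈ K) (x y : G) : x * y * x⁻¹ * y⁻¹ ∈ K := by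
  obtain ⟨a, ha, m, hm, rfl⟩ := Subgroup.exists_mul_eq_of_sup_eq_top hA x
  obtain ⟨b, hb, m', hm', rfl⟩ := Subgroup.exists_mul_eq_of_sup_eq_top hB y
  have h1 := (QuotientGroup.eq_one_iff (N := K) m).2 (hMK hm)
  have h2 := (QuotientGroup.eq_one_iff (N := K) m').2 (hMK hm')
  have h3 := (QuotientGroup.eq_one_iff (N := K) _).2 (hc a ha b hb)
  rw [← QuotientGroup.eq_one_iff]
  simpa [h1, h2] using h3

section IdComp

variable {G : Type*} [Group G] [TopologicalSpace G]

variable [IsTopologicalGroup G]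

/-- The identity component of a subgroup, as a subgroup of the ambient group. -/
def Subgroup.idComp (N : Subgroup G) : Subgroup G :=
  (Subgroup.connectedComponentOfOne N).map N.subtype

theorem Subgroup.idComp_le (N : Subgroup G) : N.idComp ≤ N := by
  rintro _ ⟨x, -, rfl⟩
  exact x.2

theorem Subgroup.isPreconnected_idComp (N : Subgroup G) : IsPreconnected (N.idComp : Set G) :=
  isPreconnected_connectedComponent.image _ continuous_subtype_val.continuousOn

theorem Subgroup.isClosed_idComp {N : Subgroup G} (hN : IsClosed (N : Set G)) :
    IsClosed (N.idComp : Set G) :=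
  hN.isClosedEmbedding_subtypeVal.isClosedMap _ isClosed_connectedComponent

theorem Subgroup.subset_idComp {N : Subgroup G} {S : Set G} (hS : IsPreconnected S)
    (h1 : (1 : G) ∈ S) (hSN : S ⊆ N) : S ⊆ N.idComp := by
  intro x hx
  have h2 : IsPreconnected ((↑) ⁻¹' S : Set N) := by
    rw [← IsInducing.subtypeVal.isPreconnected_image]
    have : ((↑) '' ((↑) ⁻¹' S : Set N) : Set G) = S :=
      Set.image_preimage_eq_of_subset fun y hy => ⟨⟨y, hSN hy⟩, rfl⟩
    exact (congrArg IsPreconnected this).mpr hS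
  exact ⟨⟨x, hSN hx⟩, h2.subset_connectedComponent (show (1 : N) ∈ _ from h1) hx, rfl⟩

theorem Subgroup.normal_idComp (N : Subgroup G) [hN : N.Normal] : N.idComp.Normal := by
  refine ⟨fun n hn g => ?_⟩
  have h := N.isPreconnected_idComp.image (fun x => g * x * g⁻¹) (by fun_prop)
  refine Subgroup.subset_idComp h ⟨1, N.idComp.one_mem, by simp⟩ ?_ ⟨n, hn, rfl⟩
  rintro _ ⟨x, hx, rfl⟩
  exact hN.conj_mem x (N.idComp_le hx) g

theorem Subgroup.totallyDisconnectedSpace_of_idComp_eq_bot {N : Subgroup G} (h : N.idComp = ⊥) :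
    TotallyDisconnectedSpace N := by
  refine ⟨fun t _ ht x hx y hy => Subtype.ext ?_⟩
  have h1 := ht.image (fun z : N => (x : G)⁻¹ * z) (by fun_prop)
  have h2 := Subgroup.subset_idComp (N := N) h1 ⟨x, hx, by simp⟩ (by
    rintro _ ⟨z, -, rfl⟩
    exact N.mul_mem (N.inv_mem x.2) z.2) ⟨y, hy, rfl⟩
  rw [h] at h2
  exact inv_mul_eq_one.1 (Subgroup.mem_bot.1 h2)

/-- Commutators with a fixed element of a normal subgroup of a connected group lie in its identity
component. -/
theorem Subgroup.commutator_mem_idComp {M : Subgroup G} [hM : M.Normal] {S : Set G}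
    (hS : IsPreconnected S) (h1 : (1 : G) ∈ S) {g m : G} (hg : g ∈ S) (hm : m ∈ M) :
    g * m * g⁻¹ * m⁻¹ ∈ M.idComp := by
  have h2 := hS.image (fun x => x * m * x⁻¹ * m⁻¹) (by fun_prop)
  refine Subgroup.subset_idComp h2 ⟨1, h1, by simp⟩ ?_ ⟨g, hg, rfl⟩
  rintro _ ⟨x, -, rfl⟩
  exact M.mul_mem (hM.conj_mem m hm x) (M.inv_mem hm)

theorem Subgroup.isClosed_sup [CompactSpace G] [T2Space G] {A B : Subgroup G} [B.Normal]
    (hA : IsClosed (A : Set G)) (hB : IsClosed (B : Set G)) :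
    IsClosed ((A ⊔ B : Subgroup G) : Set G) := by
  rw [Subgroup.mul_normal]
  exact (hA.isCompact.mul hB.isCompact).isClosed

variable [CompactSpace G] [T2Space G]

theorem Subgroup.IsMaxClosedNormal.sup_eq_top {M M' : Subgroup G} (hM : M.IsMaxClosedNormal)
    (hM' : M'.IsMaxClosedNormal) (hne : M' ≠ M) : M' ⊔ M = ⊤ := by
  by_contra h
  have := hM.normal
  have := hM'.normal
  have h1 := hM.eq_of_le _ inferInstance (Subgroup.isClosed_sup hM'.isClosed hM.isClosed)
    le_sup_right h
  exact hne (hM'.eq_of_le M hM.normal hM.isClosed (h1 ▸ le_sup_left) hM.ne_top).symm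

variable [PreconnectedSpace G]

theorem Subgroup.inf_sup_eq_top (hchar : ∀ χ : G →* Circle, Continuous χ → ∀ g, χ g = 1)
    {A B M : Subgroup G} [hAn : A.Normal] [hBn : B.Normal] [M.Normal] (hAc : IsClosed (A : Set G))
    (hBc : IsClosed (B : Set G)) (hMc : IsClosed (M : Set G)) (hA : A ⊔ M = ⊤) (hB : B ⊔ M = ⊤) :
    (A ⊓ B) ⊔ M = ⊤ := by
  refine Subgroup.eq_top_of_commutator_mem hchar _ (Subgroup.isClosed_sup (hAc.inter hBc) hMc)
    (Subgroup.mul_mul_inv_mul_inv_mem_of_sup_eq_top hA hB le_sup_right fun a ha b hb =>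
      (le_sup_left : A ⊓ B ≤ _) ⟨?_, ?_⟩)
  · have := A.mul_mem ha (hAn.conj_mem _ (A.inv_mem ha) b)
    simpa [mul_assoc] using this
  · exact B.mul_mem (hBn.conj_mem b hb a) (B.inv_mem hb)

theorem Subgroup.iInf_sup_eq_top (hchar : ∀ χ : G →* Circle, Continuous χ → ∀ g, χ g = 1)
    {ι : Type*} {A : ι → Subgroup G} {M : Subgroup G} (hAn : ∀ i, (A i).Normal) [M.Normal]
    (hAc : ∀ i, IsClosed (A i : Set G)) (hMc : IsClosed (M : Set G)) (hA : ∀ i, A i ⊔ M = ⊤) :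
    (⨅ i, A i) ⊔ M = ⊤ := by
  classical
  have hfin : ∀ u : Finset ι, (⨅ i ∈ u, A i).Normal ∧ IsClosed ((⨅ i ∈ u, A i : Subgroup G) : Set G)
      ∧ (⨅ i ∈ u, A i) ⊔ M = ⊤ := by
    intro u
    induction u using Finset.induction_on with
    | empty => simp
    | insert i u _ ih =>
      obtain ⟨h1, h2, h3⟩ := ih
      have := hAn i
      rw [Finset.iInf_insert]
      exact ⟨inferInstance, (hAc i).inter h2, Subgroup.inf_sup_eq_top hchar (hAc i) h2 hMc (hA i) h3⟩
  rw [Subgroup.eq_top_iff']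
  intro g
  have hcl : IsClosed ((fun x => x⁻¹ * g) ⁻¹' (M : Set G)) := hMc.preimage (by fun_prop)
  obtain ⟨x, hx, hx'⟩ := hcl.isCompact.inter_iInter_nonempty (fun i => (A i : Set G)) hAc
    fun u => by
      have := (hfin u).2.2
      obtain ⟨a, ha, m, hm, rfl⟩ := Subgroup.exists_mul_eq_of_sup_eq_top this g
      refine ⟨a, by simpa using hm, ?_⟩
      simpa [Subgroup.mem_iInf] using ha
  have h1 : x ∈ ⨅ i, A i := by simpa [Subgroup.mem_iInf] using hx'
  have h2 := Subgroup.mul_mem_sup h1 (show x⁻¹ * g ∈ M from hx)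
  simpa using h2

theorem Subgroup.idComp_sup_eq_top (hchar : ∀ χ : G →* Circle, Continuous χ → ∀ g, χ g = 1)
    {A M : Subgroup G} [A.Normal] [M.Normal] (hAc : IsClosed (A : Set G))
    (hMc : IsClosed (M : Set G)) (hA : A ⊔ M = ⊤) : A.idComp ⊔ M = ⊤ := by
  have := A.normal_idComp
  refine Subgroup.eq_top_of_commutator_mem hchar _
    (Subgroup.isClosed_sup (Subgroup.isClosed_idComp hAc) hMc)
    (Subgroup.mul_mul_inv_mul_inv_mem_of_sup_eq_top hA hA le_sup_right fun a _ b hb =>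
      (le_sup_left : A.idComp ≤ _) ?_)
  exact Subgroup.commutator_mem_idComp isPreconnected_univ trivial trivial hb

theorem Subgroup.exists_isMaxClosedNormal_not_le
    (hchar : ∀ χ : G →* Circle, Continuous χ → ∀ g, χ g = 1) {N : Subgroup G} [N.Normal]
    (hN : IsClosed (N : Set G)) (hNc : IsPreconnected (N : Set G)) (h : N ≠ ⊥) :
    ∃ M : Subgroup G, M.IsMaxClosedNormal ∧ ¬ N ≤ M := by
  obtain ⟨n₀, hn₀, hne⟩ := N.bot_or_exists_ne_one.resolve_left h
  obtain ⟨n, ρ, hρ, hu, hρg⟩ := exists_unitaryGroup_rep_ne_one hne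
  exact Subgroup.exists_isMaxClosedNormal_of_rep hchar hρ hu N hN hNc hn₀ hρg

/-- The intersection of all maximal closed normal subgroups has trivial identity component. -/
theorem Subgroup.idComp_iInf_isMaxClosedNormal
    (hchar : ∀ χ : G →* Circle, Continuous χ → ∀ g, χ g = 1) :
    (⨅ M : {M : Subgroup G // M.IsMaxClosedNormal}, M.1).idComp = ⊥ := by
  by_contra h
  have hn : (⨅ M : {M : Subgroup G // M.IsMaxClosedNormal}, M.1).Normal :=
    Subgroup.normal_iInf_normal fun M => M.2.normal
  have hc : IsClosed ((⨅ M : {M : Subgroup G // M.IsMaxClosedNormal}, M.1 : Subgroup G) : Set G) := by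
    rw [Subgroup.coe_iInf]
    exact isClosed_iInter fun M => M.2.isClosed
  have := Subgroup.normal_idComp (⨅ M : {M : Subgroup G // M.IsMaxClosedNormal}, M.1)
  obtain ⟨M, hM, hle⟩ := Subgroup.exists_isMaxClosedNormal_not_le hchar
    (Subgroup.isClosed_idComp hc) (Subgroup.isPreconnected_idComp _) h
  exact hle ((Subgroup.idComp_le _).trans
    (iInf_le (fun M : {M : Subgroup G // M.IsMaxClosedNormal} => M.1) ⟨M, hM⟩))
end IdComp

section SimplyConnected

theorem SimplyConnectedSpace.of_retract {X Y : Type*} [TopologicalSpace X] [TopologicalSpace Y]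
    [SimplyConnectedSpace X] {i : Y → X} {r : X → Y} (hi : Continuous i) (hr : Continuous r)
    (h : ∀ y, r (i y) = y) : SimplyConnectedSpace Y := by
  have hsurj : Function.Surjective r := fun y => ⟨i y, h y⟩
  refine simply_connected_iff_paths_homotopic'.2 ⟨hsurj.pathConnectedSpace hr, fun {x y} p q => ?_⟩
  have h1 := (simply_connected_iff_paths_homotopic'.1 ‹_›).2 (p.map hi) (q.map hi)
  have h2 := h1.map ⟨r, hr⟩
  obtain ⟨F⟩ := h2
  have hp : ∀ p : Path x y, p = ((p.map hi).map hr).cast (h x).symm (h y).symm := fun p => by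
    ext t
    exact (h _).symm
  rw [hp p, hp q]
  exact ⟨F.pathCast (h x).symm (h y).symm⟩

theorem SimplyConnectedSpace.pi {ι : Type*} {X : ι → Type*} [∀ i, TopologicalSpace (X i)]
    [∀ i, SimplyConnectedSpace (X i)] : SimplyConnectedSpace (∀ i, X i) := by
  refine simply_connected_iff_paths_homotopic.2 ⟨?_, fun x y => ⟨fun p q => ?_⟩⟩
  · refine ⟨⟨fun i => Classical.arbitrary _⟩, fun x y => ?_⟩
    exact ⟨Path.pi fun i => PathConnectedSpace.somePath (x i) (y i)⟩
  · rw [← Path.Homotopic.pi_proj p, ← Path.Homotopic.pi_proj q]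
    congr 1
    funext i
    exact Subsingleton.elim _ _

end SimplyConnected

section Factor

variable {G : Type*} [Group G] [TopologicalSpace G] [IsTopologicalGroup G]

/-- The connected normal subgroup complementary to a maximal closed normal subgroup. -/
def Subgroup.simpleFactor (M : Subgroup G) : Subgroup G :=
  (⨅ M' : {M' : Subgroup G // M'.IsMaxClosedNormal ∧ M' ≠ M}, M'.1).idComp

variable {M M' : Subgroup G}

instance Subgroup.simpleFactor_normal : M.simpleFactor.Normal := by
  have : (⨅ M' : {M' : Subgroup G // M'.IsMaxClosedNormal ∧ M' ≠ M}, M'.1).Normal :=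
    Subgroup.normal_iInf_normal fun M' => M'.2.1.normal
  exact Subgroup.normal_idComp _

theorem Subgroup.isClosed_simpleFactor : IsClosed (M.simpleFactor : Set G) := by
  refine Subgroup.isClosed_idComp ?_
  rw [Subgroup.coe_iInf]
  exact isClosed_iInter fun M' => M'.2.1.isClosed

theorem Subgroup.isPreconnected_simpleFactor : IsPreconnected (M.simpleFactor : Set G) :=
  Subgroup.isPreconnected_idComp _

theorem Subgroup.simpleFactor_le (hM' : M'.IsMaxClosedNormal) (hne : M' ≠ M) :
    M.simpleFactor ≤ M'.idComp :=
  Subgroup.subset_idComp Subgroup.isPreconnected_simpleFactor (Subgroup.one_mem _)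
    ((Subgroup.idComp_le _).trans (iInf_le
      (fun M' : {M' : Subgroup G // M'.IsMaxClosedNormal ∧ M' ≠ M} => M'.1) ⟨M', hM', hne⟩))

theorem Subgroup.simpleFactor_inf_le :
    M.simpleFactor ⊓ M ≤ ⨅ M : {M : Subgroup G // M.IsMaxClosedNormal}, M.1 := by
  refine le_iInf fun M' => ?_
  by_cases h : M'.1 = M
  · exact h ▸ inf_le_right
  · exact inf_le_left.trans ((simpleFactor_le M'.2 h).trans (idComp_le _))

variable [CompactSpace G] [T2Space G] [PreconnectedSpace G]

theorem Subgroup.simpleFactor_sup_eq_top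
    (hchar : ∀ χ : G →* Circle, Continuous χ → ∀ g, χ g = 1) (hM : M.IsMaxClosedNormal) :
    M.simpleFactor ⊔ M = ⊤ := by
  have := hM.normal
  have : (⨅ M' : {M' : Subgroup G // M'.IsMaxClosedNormal ∧ M' ≠ M}, M'.1).Normal :=
    Subgroup.normal_iInf_normal fun M' => M'.2.1.normal
  refine Subgroup.idComp_sup_eq_top hchar ?_ hM.isClosed ?_
  · rw [Subgroup.coe_iInf]
    exact isClosed_iInter fun M' => M'.2.1.isClosed
  · exact Subgroup.iInf_sup_eq_top hchar (fun M' => M'.2.1.normal) (fun M' => M'.2.1.isClosed)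
      hM.isClosed fun M' => hM.sup_eq_top M'.2.1 M'.2.2

theorem Subgroup.simpleFactor_sup_idComp_eq_top
    (hchar : ∀ χ : G →* Circle, Continuous χ → ∀ g, χ g = 1) (hM : M.IsMaxClosedNormal) :
    M.simpleFactor ⊔ M.idComp = ⊤ := by
  have := hM.normal
  rw [sup_comm]
  refine Subgroup.idComp_sup_eq_top hchar hM.isClosed Subgroup.isClosed_simpleFactor ?_
  rw [sup_comm, Subgroup.simpleFactor_sup_eq_top hchar hM]

theorem Subgroup.totallyDisconnectedSpace_iInf_isMaxClosedNormal
    (hchar : ∀ χ : G →* Circle, Continuous χ → ∀ g, χ g = 1) :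
    TotallyDisconnectedSpace (⨅ M : {M : Subgroup G // M.IsMaxClosedNormal}, M.1 : Subgroup G) :=
  Subgroup.totallyDisconnectedSpace_of_idComp_eq_bot (Subgroup.idComp_iInf_isMaxClosedNormal hchar)

theorem Subgroup.commute_of_mem_simpleFactor
    (hchar : ∀ χ : G →* Circle, Continuous χ → ∀ g, χ g = 1) (hM : M.IsMaxClosedNormal) {s m : G}
    (hs : s ∈ M.simpleFactor) (hm : m ∈ M) : s * m = m * s := by
  have := hM.normal
  have hmem : ∀ x ∈ M.simpleFactor, x * m * x⁻¹ * m⁻¹ ∈ M.simpleFactor ⊓ M := fun x hx => by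
    refine ⟨?_, M.mul_mem (hM.normal.conj_mem m hm x) (M.inv_mem hm)⟩
    have := M.simpleFactor.mul_mem hx
      (Subgroup.simpleFactor_normal.conj_mem _ (M.simpleFactor.inv_mem hx) m)
    simpa [mul_assoc] using this
  have h2 := Subgroup.isPreconnected_simpleFactor (M := M).image
    (fun x => x * m * x⁻¹ * m⁻¹) (by fun_prop)
  have h3 := Subgroup.subset_idComp h2 ⟨1, M.simpleFactor.one_mem, by simp⟩ (by
    rintro _ ⟨x, hx, rfl⟩
    exact Subgroup.simpleFactor_inf_le (hmem x hx)) ⟨s, hs, rfl⟩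
  rw [Subgroup.idComp_iInf_isMaxClosedNormal hchar] at h3
  have h4 : s * m * s⁻¹ * m⁻¹ = 1 := h3
  rw [mul_inv_eq_one, mul_inv_eq_iff_eq_mul] at h4
  exact h4

end Factor

section Projection

variable {G : Type*} [Group G] [TopologicalSpace G] [IsTopologicalGroup G] [CompactSpace G]
  [T2Space G] [SimplyConnectedSpace G] [LocallyPathConnectedSpace G] {M : Subgroup G}

theorem Subgroup.exists_projection_simpleFactor (hM : M.IsMaxClosedNormal) :
    ∃ π : G →* M.simpleFactor, Continuous π ∧ (∀ s : M.simpleFactor, π s = s) ∧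
      ∀ g, π g = 1 ↔ g ∈ M.idComp := by
  have hchar : ∀ χ : G →* Circle, Continuous χ → ∀ g, χ g = 1 :=
    fun χ hχ g => χ.circle_eq_one_of_simplyConnected hχ g
  have := hM.normal
  have := M.normal_idComp
  let φ : M.simpleFactor × M.idComp →* G :=
    { toFun := fun x => x.1 * x.2
      map_one' := by simp
      map_mul' := fun x y => by
        have := Subgroup.commute_of_mem_simpleFactor hchar hM y.1.2 (M.idComp_le x.2.2)
        simp only [Prod.fst_mul, Prod.snd_mul, Subgroup.coe_mul]
        rw [mul_assoc, ← mul_assoc (y.1 : G), this]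
        simp only [mul_assoc] }
  have hφ : Continuous φ := by
    change Continuous fun x : M.simpleFactor × M.idComp => (x.1 : G) * x.2
    fun_prop
  have hsurj : Function.Surjective φ := fun g => by
    obtain ⟨a, ha, b, hb, rfl⟩ := Subgroup.exists_mul_eq_of_sup_eq_top
      (Subgroup.simpleFactor_sup_idComp_eq_top hchar hM) g
    exact ⟨(⟨a, ha⟩, ⟨b, hb⟩), rfl⟩
  have : CompactSpace M.simpleFactor :=
    isCompact_iff_compactSpace.1 Subgroup.isClosed_simpleFactor.isCompact
  have : CompactSpace M.idComp :=
    isCompact_iff_compactSpace.1 (Subgroup.isClosed_idComp hM.isClosed).isCompact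
  have : PreconnectedSpace M.simpleFactor :=
    Subtype.preconnectedSpace Subgroup.isPreconnected_simpleFactor
  have : PreconnectedSpace M.idComp := Subtype.preconnectedSpace (Subgroup.isPreconnected_idComp _)
  have := Subgroup.totallyDisconnectedSpace_iInf_isMaxClosedNormal hchar
  have hk : ∀ x : φ.ker, (x.1.1 : G) = (x.1.2 : G)⁻¹ := fun x => eq_inv_of_mul_eq_one_left x.2
  have : TotallyDisconnectedSpace φ.ker := by
    refine totallyDisconnectedSpace_of_injective
      (f := fun x : φ.ker => (⟨x.1.1, Subgroup.simpleFactor_inf_le ⟨x.1.1.2, ?_⟩⟩ :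
        (⨅ M : {M : Subgroup G // M.IsMaxClosedNormal}, M.1 : Subgroup G))) ?_ ?_
    · rw [hk]
      exact M.inv_mem (M.idComp_le x.1.2.2)
    · fun_prop
    · intro x y hxy
      have h1 : (x.1.1 : G) = y.1.1 := congrArg
        (fun z : (⨅ M : {M : Subgroup G // M.IsMaxClosedNormal}, M.1 : Subgroup G) => (z : G)) hxy
      have h2 : (x.1.2 : G) = y.1.2 := by rw [← inv_inj, ← hk, ← hk, h1]
      exact Subtype.ext (Prod.ext (Subtype.ext h1) (Subtype.ext h2))
  have hinj := φ.injective_of_totallyDisconnected_ker hφ hsurj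
  let e := MulEquiv.ofBijective φ ⟨hinj, hsurj⟩
  have he : Continuous e.symm := (hφ.homeoOfEquivCompactToT2 (f := e.toEquiv)).continuous_symm
  refine ⟨(MonoidHom.fst _ _).comp e.symm.toMonoidHom, continuous_fst.comp he, fun s => ?_,
    fun g => ?_⟩
  · have : e.symm s = (s, 1) := by
      rw [MulEquiv.symm_apply_eq]
      exact (mul_one (s : G)).symm
    exact congrArg Prod.fst this
  · obtain ⟨⟨s, m⟩, rfl⟩ := e.surjective g
    have h1 : (MonoidHom.fst _ _).comp e.symm.toMonoidHom (e (s, m)) = s :=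
      congrArg Prod.fst (e.symm_apply_apply (s, m))
    rw [h1]
    constructor
    · rintro rfl
      change (1 : G) * m ∈ _
      rw [one_mul]; exact m.2
    · intro hmem
      have hs : (s : G) ∈ M.idComp := (M.idComp.mul_mem_cancel_right m.2).1 hmem
      have h2 : φ (s, 1) = φ (1, ⟨s, hs⟩) := by
        change (s : G) * (1 : G) = (1 : G) * s
        rw [mul_one, one_mul]
      exact congrArg Prod.fst (hinj h2)

end Projection

section Simple

/-- A compact group with a totally disconnected extension structure over a topologically simple
group has only finite proper closed normal subgroups once the kernel is finite. -/
theorem MonoidHom.finite_of_normal_of_finite_ker {S P : Type*} [Group S] [TopologicalSpace S]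
    [IsTopologicalGroup S] [CompactSpace S] [PreconnectedSpace S] [Group P]
    [TopologicalSpace P] [T2Space P] (p : S →* P) (hp : Continuous p)
    (hsurj : Function.Surjective p) [Finite p.ker]
    (hsimple : ∀ N : Subgroup P, N.Normal → IsClosed (N : Set P) → N = ⊥ ∨ N = ⊤)
    (N : Subgroup S) (hN : N.Normal) (hNc : IsClosed (N : Set S)) (hne : N ≠ ⊤) : Finite N := by
  rcases hsimple (N.map p) (hN.map p hsurj) (by
    rw [Subgroup.coe_map]
    exact (hNc.isCompact.image hp).isClosed) with h | h
  · have hle : N ≤ p.ker := (Subgroup.map_eq_bot_iff _).1 h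
    exact Finite.of_injective _ (Subgroup.inclusion_injective hle)
  · exfalso
    apply hne
    have : Finite (S ⧸ N) := by
      refine Finite.of_surjective (fun k : p.ker => ((k : S) : S ⧸ N)) fun x => ?_
      obtain ⟨s, rfl⟩ := QuotientGroup.mk_surjective x
      obtain ⟨n, hn, hns⟩ : p s ∈ N.map p := h ▸ Subgroup.mem_top _
      refine ⟨⟨s * n⁻¹, ?_⟩, ?_⟩
      · rw [MonoidHom.mem_ker, map_mul, map_inv, hns, mul_inv_cancel]
      · refine QuotientGroup.eq.2 ?_
        simpa using hn
    have : N.FiniteIndex := Subgroup.finiteIndex_of_finite_quotient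
    have ho := N.isOpen_of_isClosed_of_finiteIndex hNc
    have := IsClopen.eq_univ ⟨hNc, ho⟩ ⟨1, N.one_mem⟩
    exact SetLike.coe_injective this

theorem IsTopManifold.of_group {S : Type u} [Group S] [TopologicalSpace S] [IsTopologicalGroup S]
    {n : ℕ} {U : Set S} {V : Set (EuclideanSpace ℝ (Fin n))} (hU : IsOpen U) (h1 : 1 ∈ U)
    (hV : IsOpen V) (e : U ≃ₜ V) : IsTopManifold S := fun x => by
  let τ := Homeomorph.mulLeft x
  refine ⟨n, τ '' U, V, τ.isOpenMap U hU, ⟨1, h1, mul_one x⟩, hV, ⟨(τ.image U).symm.trans e⟩⟩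

theorem MonoidHom.exists_chart_of_totallyDisconnected_ker {S P : Type*} [Group S]
    [TopologicalSpace S] [IsTopologicalGroup S] [CompactSpace S] [T2Space S] [PreconnectedSpace S]
    [LocallyPathConnectedSpace S] [Group P] [TopologicalSpace P] [IsTopologicalGroup P]
    [CompactSpace P] [T2Space P] (p : S →* P) (hp : Continuous p) (hsurj : Function.Surjective p)
    [TotallyDisconnectedSpace p.ker]
    {n : ℕ} {B : Set P} {V : Set (EuclideanSpace ℝ (Fin n))} (hB : IsOpen B) (h1 : 1 ∈ B)
    (hV : IsOpen V) (hVc : Convex ℝ V) (e : B ≃ₜ V) :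
    ∃ (W : Set S) (V' : Set (EuclideanSpace ℝ (Fin n))), IsOpen W ∧ 1 ∈ W ∧ IsOpen V' ∧
      Set.InjOn p W ∧ Nonempty (W ≃ₜ V') := by
  have : LocallyPathConnectedSpace V := hV.locallyPathConnectedSpace
  have : LocallyPathConnectedSpace B := e.isOpenEmbedding.locallyPathConnectedSpace
  have : ContractibleSpace V := hVc.contractibleSpace ⟨e ⟨1, h1⟩, (e ⟨1, h1⟩).2⟩
  have : ContractibleSpace B := e.contractibleSpace
  let W := connectedComponentIn (p ⁻¹' B) 1
  have h1' : (1 : S) ∈ p ⁻¹' B := by simpa using h1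
  have hW : IsOpen W := (hB.preimage hp).connectedComponentIn
  have hW1 : (1 : S) ∈ W := mem_connectedComponentIn h1'
  have hWB : ∀ w ∈ W, p w ∈ B := fun w hw =>
    show w ∈ p ⁻¹' B from connectedComponentIn_subset _ _ hw
  have : PreconnectedSpace W := Subtype.preconnectedSpace isPreconnected_connectedComponentIn
  have hinj : Set.InjOn p W := fun x hx y hy hxy =>
    p.eq_of_lift_of_totallyDisconnected_ker hp hsurj (f := fun b : B => (b : P))
      continuous_subtype_val (h := fun w : W => (w : S)) continuous_subtype_val
      (q := fun w : W => (⟨p w, hWB w w.2⟩ : B)) (by fun_prop) (fun _ => rfl)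
      (y := ⟨x, hx⟩) (y' := ⟨y, hy⟩) (Subtype.ext hxy)
  have hop : IsOpenMap p :=
    MonoidHom.isOpenMap_of_sigmaCompact p hsurj hp
  let j : W → EuclideanSpace ℝ (Fin n) := fun w => e ⟨p w, hWB w w.2⟩
  have hj : IsOpenEmbedding j := by
    refine IsOpenEmbedding.of_continuous_injective_isOpenMap (by fun_prop) ?_ ?_
    · intro x y hxy
      have := e.injective (Subtype.ext hxy)
      exact Subtype.ext (hinj x.2 y.2 (congrArg Subtype.val this))
    · refine (hV.isOpenMap_subtype_val.comp e.isOpenMap).comp ?_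
      exact (hop.comp hW.isOpenMap_subtype_val).codRestrict _
  exact ⟨W, Set.range j, hW, hW1, hj.isOpen_range, hinj, ⟨hj.isEmbedding.toHomeomorph⟩⟩

open scoped Matrix Matrix.Norms.Operator in
/-- A compact, connected, locally path connected group which is an extension of a nontrivial
topologically simple compact group by a totally disconnected one is a Lie group all of whose
proper closed normal subgroups are finite. -/
theorem MonoidHom.isTopManifold_and_finite_of_simple {S : Type u} {P : Type*} [Group S]
    [TopologicalSpace S] [IsTopologicalGroup S] [CompactSpace S] [T2Space S] [PreconnectedSpace S]
    [LocallyPathConnectedSpace S] [Group P] [TopologicalSpace P] [IsTopologicalGroup P]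
    [CompactSpace P] [T2Space P] [Nontrivial P] (p : S →* P) (hp : Continuous p)
    (hsurj : Function.Surjective p) [TotallyDisconnectedSpace p.ker]
    (hsimple : ∀ N : Subgroup P, N.Normal → IsClosed (N : Set P) → N = ⊥ ∨ N = ⊤) :
    IsTopManifold S ∧
      ∀ N : Subgroup S, N.Normal → IsClosed (N : Set S) → N ≠ ⊤ → Finite N := by
  obtain ⟨g, hg⟩ := exists_ne (1 : P)
  obtain ⟨n, ρ, hρ, -, hρg⟩ := exists_unitaryGroup_rep_ne_one hg
  have hker : ρ.ker = ⊥ := by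
    refine (hsimple ρ.ker inferInstance ?_).resolve_right fun h => hρg ?_
    · exact isClosed_singleton.preimage hρ
    · exact (h ▸ Subgroup.mem_top g : g ∈ ρ.ker)
  obtain ⟨m, B, V, hB, h1, hV, hVc, ⟨e⟩⟩ :=
    ρ.exists_homeomorph_convex_of_injective hρ ((MonoidHom.ker_eq_bot_iff ρ).1 hker)
  obtain ⟨W, V', hW, hW1, hV', hinj, ⟨e'⟩⟩ :=
    p.exists_chart_of_totallyDisconnected_ker hp hsurj hB h1 hV hVc e
  refine ⟨IsTopManifold.of_group hW hW1 hV' e', ?_⟩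
  have : CompactSpace p.ker :=
    isCompact_iff_compactSpace.1 (isClosed_singleton.preimage hp : IsClosed (p.ker : Set S)).isCompact
  have : DiscreteTopology p.ker := by
    refine discreteTopology_of_isOpen_singleton_one ?_
    have : ({1} : Set p.ker) = Subtype.val ⁻¹' W := by
      ext k
      refine ⟨fun h => ?_, fun h => Subtype.ext (hinj h hW1 ?_)⟩
      · rw [Set.mem_singleton_iff.1 h]
        exact hW1
      · exact k.2.trans (map_one p).symm
    rw [this]
    exact hW.preimage continuous_subtype_val
  have : Finite p.ker := finite_of_compact_of_discrete
  exact p.finite_of_normal_of_finite_ker hp hsurj hsimple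

end Simple

section Product

theorem Subgroup.compactSpace_simpleFactor {G : Type*} [Group G] [TopologicalSpace G]
    [IsTopologicalGroup G] [CompactSpace G] (M : Subgroup G) : CompactSpace M.simpleFactor :=
  isCompact_iff_compactSpace.1 Subgroup.isClosed_simpleFactor.isCompact

variable {G : Type u} [Group G] [TopologicalSpace G] [IsTopologicalGroup G] [CompactSpace G]
  [T2Space G] [SimplyConnectedSpace G] [LocallyPathConnectedSpace G] {M : Subgroup G}

theorem Subgroup.simplyConnectedSpace_simpleFactor (hM : M.IsMaxClosedNormal) :
    SimplyConnectedSpace M.simpleFactor := by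
  obtain ⟨π, hπ, hid, -⟩ := Subgroup.exists_projection_simpleFactor hM
  exact .of_retract continuous_subtype_val hπ hid

theorem Subgroup.locallyPathConnectedSpace_simpleFactor (hM : M.IsMaxClosedNormal) :
    LocallyPathConnectedSpace M.simpleFactor := by
  obtain ⟨π, hπ, hid, -⟩ := Subgroup.exists_projection_simpleFactor hM
  have hsurj : Function.Surjective π := fun s => ⟨s, hid s⟩
  exact (IsQuotientMap.of_surjective_continuous hsurj hπ).locallyPathConnectedSpace

theorem Subgroup.exists_mul_ne_mul_simpleFactor (hM : M.IsMaxClosedNormal) :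
    ∃ a b : M.simpleFactor, a * b ≠ b * a := by
  have hchar : ∀ χ : G →* Circle, Continuous χ → ∀ g, χ g = 1 :=
    fun χ hχ g => χ.circle_eq_one_of_simplyConnected hχ g
  have := M.compactSpace_simpleFactor
  have := simplyConnectedSpace_simpleFactor hM
  have := locallyPathConnectedSpace_simpleFactor hM
  by_contra! hcomm
  have h1 : (⊥ : Subgroup M.simpleFactor) = ⊤ := by
    refine Subgroup.eq_top_of_commutator_mem
      (fun χ hχ g => χ.circle_eq_one_of_simplyConnected hχ g) ⊥ ?_ fun a b => ?_
    · rw [Subgroup.coe_bot]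
      exact isClosed_singleton
    · rw [Subgroup.mem_bot, hcomm a b, mul_inv_cancel_right, mul_inv_cancel]
  have h2 : M.simpleFactor = ⊥ := by
    rw [eq_bot_iff]
    intro x hx
    have : (⟨x, hx⟩ : M.simpleFactor) ∈ (⊥ : Subgroup M.simpleFactor) := h1 ▸ Subgroup.mem_top _
    exact congrArg Subtype.val this
  have h3 := Subgroup.simpleFactor_sup_eq_top hchar hM
  rw [h2, bot_sup_eq] at h3
  exact hM.ne_top h3

theorem Subgroup.isTopManifold_and_finite_simpleFactor (hM : M.IsMaxClosedNormal) :
    IsTopManifold M.simpleFactor ∧ ∀ N : Subgroup M.simpleFactor, N.Normal →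
      IsClosed (N : Set M.simpleFactor) → N ≠ ⊤ → Finite N := by
  have hchar : ∀ χ : G →* Circle, Continuous χ → ∀ g, χ g = 1 :=
    fun χ hχ g => χ.circle_eq_one_of_simplyConnected hχ g
  have := M.compactSpace_simpleFactor
  have := simplyConnectedSpace_simpleFactor hM
  have := locallyPathConnectedSpace_simpleFactor hM
  have := hM.normal
  have := hM.isClosed
  have : Nontrivial (G ⧸ M) := QuotientGroup.nontrivial_iff.2 hM.ne_top
  let p : M.simpleFactor →* G ⧸ M := (QuotientGroup.mk' M).comp M.simpleFactor.subtype
  have hp : Continuous p := QuotientGroup.continuous_mk.comp continuous_subtype_val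
  have hsurj : Function.Surjective p := fun x => by
    obtain ⟨g, rfl⟩ := QuotientGroup.mk_surjective x
    obtain ⟨a, ha, b, hb, rfl⟩ := Subgroup.exists_mul_eq_of_sup_eq_top
      (Subgroup.simpleFactor_sup_eq_top hchar hM) g
    refine ⟨⟨a, ha⟩, QuotientGroup.eq.2 ?_⟩
    simpa using hb
  have := Subgroup.totallyDisconnectedSpace_iInf_isMaxClosedNormal hchar
  have hk : ∀ x : p.ker, (x : G) ∈ M := fun x => (QuotientGroup.eq_one_iff _).1 x.2
  have : TotallyDisconnectedSpace p.ker := by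
    refine totallyDisconnectedSpace_of_injective
      (f := fun x : p.ker => (⟨x, Subgroup.simpleFactor_inf_le ⟨x.1.2, hk x⟩⟩ :
        (⨅ M : {M : Subgroup G // M.IsMaxClosedNormal}, M.1 : Subgroup G))) (by fun_prop) ?_
    intro x y hxy
    exact Subtype.ext (Subtype.ext (congrArg
      (fun z : (⨅ M : {M : Subgroup G // M.IsMaxClosedNormal}, M.1 : Subgroup G) => (z : G)) hxy))
  refine p.isTopManifold_and_finite_of_simple hp hsurj fun N hN hNc => ?_
  rw [or_iff_not_imp_right]
  intro hne
  have hsm : Function.Surjective (QuotientGroup.mk' M) := QuotientGroup.mk'_surjective M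
  have h1 : N.comap (QuotientGroup.mk' M) = M := by
    refine hM.eq_of_le _ (hN.comap _) (hNc.preimage QuotientGroup.continuous_mk) ?_ fun h => hne ?_
    · intro m hm
      have : (m : G ⧸ M) = 1 := (QuotientGroup.eq_one_iff _).2 hm
      change (m : G ⧸ M) ∈ N
      rw [this]
      exact N.one_mem
    · rw [← Subgroup.map_comap_eq_self_of_surjective hsm N, h,
        Subgroup.map_top_of_surjective _ hsm]
  rw [← Subgroup.map_comap_eq_self_of_surjective hsm N, h1]
  exact (Subgroup.map_eq_bot_iff _).2 (QuotientGroup.ker_mk' M).ge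

theorem exists_mulEquiv_pi_simpleFactor :
    ∃ e : G ≃* (∀ M : {M : Subgroup G // M.IsMaxClosedNormal}, M.1.simpleFactor),
      IsTopGroupIso e := by
  classical
  have hchar : ∀ χ : G →* Circle, Continuous χ → ∀ g, χ g = 1 :=
    fun χ hχ g => χ.circle_eq_one_of_simplyConnected hχ g
  choose π hπ hid hker using
    fun M : {M : Subgroup G // M.IsMaxClosedNormal} => Subgroup.exists_projection_simpleFactor M.2
  have : ∀ M : {M : Subgroup G // M.IsMaxClosedNormal}, SimplyConnectedSpace M.1.simpleFactor :=
    fun M => Subgroup.simplyConnectedSpace_simpleFactor M.2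
  let Φ : G →* (∀ M : {M : Subgroup G // M.IsMaxClosedNormal}, M.1.simpleFactor) := MonoidHom.pi π
  have hΦ : Continuous Φ := continuous_pi hπ
  have hsurj : Function.Surjective Φ := fun x => by
    have hfin : ∀ u : Finset {M : Subgroup G // M.IsMaxClosedNormal},
        ∃ g, (∀ M ∈ u, π M g = x M) ∧ ∀ M, M ∉ u → π M g = 1 := fun u => by
      induction u using Finset.induction_on with
      | empty => exact ⟨1, by simp, fun M _ => map_one _⟩
      | insert M u hMu ih =>
        obtain ⟨g, hg1, hg2⟩ := ih
        have hx : ∀ M', M' ≠ M → π M' (x M) = 1 := fun M' hne =>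
          (hker M' _).2 (Subgroup.simpleFactor_le M'.2 (fun h => hne (Subtype.ext h)) (x M).2)
        refine ⟨x M * g, fun M' hM' => ?_, fun M' hM' => ?_⟩
        · rw [map_mul]
          rcases Finset.mem_insert.1 hM' with rfl | hM'
          · rw [hg2 _ hMu, hid, mul_one]
          · rw [hx M' fun h => hMu (h ▸ hM'), hg1 M' hM', one_mul]
        · rw [Finset.mem_insert, not_or] at hM'
          rw [map_mul, hx M' hM'.1, hg2 M' hM'.2, one_mul]
    obtain ⟨g, hg⟩ : (⋂ M, π M ⁻¹' {x M}).Nonempty := by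
      have := CompactSpace.iInter_nonempty (t := fun M => π M ⁻¹' {x M})
        (fun M => isClosed_singleton.preimage (hπ M)) fun u => by
          obtain ⟨g, hg, -⟩ := hfin u
          exact ⟨g, Set.mem_iInter₂.2 hg⟩
      exact this
    exact ⟨g, funext fun M => Set.mem_iInter.1 hg M⟩
  have : SimplyConnectedSpace (∀ M : {M : Subgroup G // M.IsMaxClosedNormal}, M.1.simpleFactor) :=
    .pi
  have := (IsQuotientMap.of_surjective_continuous hsurj hΦ).locallyPathConnectedSpace
  have := Subgroup.totallyDisconnectedSpace_iInf_isMaxClosedNormal hchar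
  have hk : ∀ g ∈ Φ.ker, g ∈ ⨅ M : {M : Subgroup G // M.IsMaxClosedNormal}, M.1 := fun g hg =>
    Subgroup.mem_iInf.2 fun M => M.1.idComp_le ((hker M g).1 (congrFun hg M))
  have : TotallyDisconnectedSpace Φ.ker := by
    refine totallyDisconnectedSpace_of_injective
      (f := fun x : Φ.ker => (⟨x, hk x x.2⟩ :
        (⨅ M : {M : Subgroup G // M.IsMaxClosedNormal}, M.1 : Subgroup G))) (by fun_prop) ?_
    intro x y hxy
    exact Subtype.ext (congrArg
      (fun z : (⨅ M : {M : Subgroup G // M.IsMaxClosedNormal}, M.1 : Subgroup G) => (z : G)) hxy)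
  let e := MulEquiv.ofBijective Φ ⟨Φ.injective_of_totallyDisconnected_ker hΦ hsurj, hsurj⟩
  exact ⟨e, hΦ, (hΦ.homeoOfEquivCompactToT2 (f := e.toEquiv)).continuous_symm⟩

end Product

/-- If a compact Hausdorff topological group `G` is, as a topological space, simply
connected and an AE(1)-compactum, then `G` is isomorphic as a topological group to a
product of simple, connected and simply connected compact Lie groups. -/
theorem simplyConnected_AE1_compact_group_is_product_of_simple_Lie_groups
    (G : Type u) [Group G] [TopologicalSpace G] [IsTopologicalGroup G]
    [CompactSpace G] [T2Space G]
    (hsc : SimplyConnectedSpace G) (hae : IsAE 1 G) :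
    ∃ (T : Type u) (L : T → CompactGroupPkg.{u}),
      (∀ t, IsSimpleSCSCLieGroup (L t)) ∧
      ∃ e : G ≃* (∀ t, (L t).carrier), IsTopGroupIso e := by
  have := hae.locallyPathConnectedSpace
  have hcpt := fun M : Subgroup G => M.compactSpace_simpleFactor
  refine ⟨{M : Subgroup G // M.IsMaxClosedNormal}, fun M => ⟨M.1.simpleFactor⟩, fun M => ?_,
    exists_mulEquiv_pi_simpleFactor⟩
  have hs := Subgroup.simplyConnectedSpace_simpleFactor M.2
  obtain ⟨h1, h2⟩ := Subgroup.isTopManifold_and_finite_simpleFactor M.2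
  exact ⟨h1, (inferInstance : ConnectedSpace M.1.simpleFactor), hs,
    Subgroup.exists_mul_ne_mul_simpleFactor M.2, h2⟩
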